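/- arXiv:1401.2174 — 2 statements merged into one kernel-verified Lean document; each statement's English description precedes it below -/
import Mathlib

section
/- Among the exceptional complex simple Lie algebras G₂, F₄, E₆, E₇, E₈, the only non-rigid gradings of Monge type are those of G₂ with Σ = {α₁} (the short simple root) and with Σ = {α₁, α₂}. -/
open scoped RealInnerProductSpace BigOperators Classical

/-- A reduced crystallographic root system in a real inner product space,
together with a chosen base of simple roots and the coordinates of each
root with respect to the base. -/
structure RootSystemBase (V : Type*) [NormedAddCommGroup V] [InnerProductSpace ℝ V] where
  /-- the set of roots -/
  Δ : Finset V
  /-- the set of simple roots (the base) -/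
  Δ0 : Finset V
  base_sub : Δ0 ⊆ Δ
  ne_zero : ∀ β ∈ Δ, β ≠ (0 : V)
  indep : LinearIndependent ℝ (fun a : ↥Δ0 => (a : V))
  neg_mem : ∀ β ∈ Δ, -β ∈ Δ
  /-- `coeff β α` is the coefficient `n_α` of the simple root `α` in `β = ∑ n_α • α` -/
  coeff : V → V → ℤ
  coeff_spec : ∀ β ∈ Δ, β = ∑ α ∈ Δ0, (coeff β α : ℝ) • α
  coeff_sign : ∀ β ∈ Δ, (∀ α ∈ Δ0, 0 ≤ coeff β α) ∨ (∀ α ∈ Δ0, coeff β α ≤ 0)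
  crystal : ∀ α ∈ Δ, ∀ β ∈ Δ, ∃ k : ℤ, 2 * ⟪β, α⟫ / ⟪α, α⟫ = (k : ℝ)
  reflect_mem : ∀ α ∈ Δ, ∀ β ∈ Δ, β - (2 * ⟪β, α⟫ / ⟪α, α⟫) • α ∈ Δ
  reduced : ∀ α ∈ Δ, (2 : ℝ) • α ∉ Δ

namespace RootSystemBase

variable {V : Type*} [NormedAddCommGroup V] [InnerProductSpace ℝ V]

variable (R : RootSystemBase V)

/-- The height `ht_Σ(β)` of a root `β` relative to a subset `Sg` of the simple roots. -/
def ht (Sg : Finset V) (β : V) : ℤ := ∑ α ∈ Sg, R.coeff β α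

/-- positive roots -/
def IsPos (β : V) : Prop := β ∈ R.Δ ∧ ∀ α ∈ R.Δ0, 0 ≤ R.coeff β α

/-- negative roots -/
def IsNeg (β : V) : Prop := β ∈ R.Δ ∧ ∀ α ∈ R.Δ0, R.coeff β α ≤ 0

/-- Irreducibility of the root system (the Dynkin diagram is connected); this is
equivalent to the corresponding complex Lie algebra being simple. -/
def Irred : Prop :=
  ¬ ∃ S : Finset V, S ⊆ R.Δ0 ∧ S.Nonempty ∧ S ≠ R.Δ0 ∧
      ∀ a ∈ S, ∀ b ∈ R.Δ0, b ∉ S → ⟪a, b⟫ = 0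

/-- Adjacency of two (simple) roots in the Dynkin diagram. -/
def Adj (a b : V) : Prop := a ≠ b ∧ ⟪a, b⟫ ≠ 0

end RootSystemBase

namespace RootSystemBase

variable {V : Type*} [NormedAddCommGroup V] [InnerProductSpace ℝ V]

/-- The Cartan pairing `⟨a, b⟩ = 2(a,b)/(b,b)`. -/
noncomputable def cInt (a b : V) : ℝ := 2 * ⟪a, b⟫ / ⟪b, b⟫

end RootSystemBase

namespace RootSystemBase

variable {V : Type*} [NormedAddCommGroup V] [InnerProductSpace ℝ V]

/-- The reflection `s_a` in the root `a`:  `s_a(v) = v - ⟨v, a⟩ a`. -/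
noncomputable def refl (a v : V) : V := v - cInt v a • a

variable (R : RootSystemBase V)

/-- `θ` is the highest root. -/
def IsHighest (θ : V) : Prop :=
  θ ∈ R.Δ ∧ ∀ β ∈ R.Δ, ∀ α ∈ R.Δ0, R.coeff β α ≤ R.coeff θ α

/-- `Δ_σ = σ(Δ⁻) ∩ Δ⁺` for the length-two Weyl group element `σ = s_a ∘ s_b`;
equivalently the positive roots mapped to negative roots by `σ⁻¹ = s_b ∘ s_a`. -/
noncomputable def Dsig (a b : V) : Finset V :=
  R.Δ.filter (fun β => R.IsPos β ∧ R.IsNeg (refl b (refl a β)))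

/-- The grading determined by `Sg` is *non-rigid*:  there is `σ = s_a ∘ s_b ∈ W²_Σ`
(`a ≠ b` simple, `Δ_σ ⊆ Δ⁺_Σ`, `|Δ_σ| = 2`) whose harmonic representative has
positive homogeneity weight, i.e.
`⟨θ, a⟩ + (⟨θ, b⟩ + 1)·ht_Σ(s_a(b)) ≥ ht_Σ(θ)`.  By Kostant's theorem this is
equivalent to the nonvanishing of `H²(𝔤₋, 𝔤)` in some positive homogeneity weight. -/
noncomputable def NonRigid (Sg : Finset V) (θ : V) : Prop :=
  ∃ a ∈ R.Δ0, ∃ b ∈ R.Δ0, a ≠ b ∧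
    (R.Dsig a b).card = 2 ∧ (∀ β ∈ R.Dsig a b, 0 < R.ht Sg β) ∧
    (R.ht Sg θ : ℝ) ≤ cInt θ a + (cInt θ b + 1) * (R.ht Sg (refl a b) : ℝ)

end RootSystemBase

namespace RootSystemBase

variable {V : Type*} [NormedAddCommGroup V] [InnerProductSpace ℝ V]

/-- `R` is the root system whose simple roots are `α 1, …, α ℓ` (standard ordering)
with Cartan matrix `M`, i.e. `M i j = ⟨αᵢ, αⱼ^∨⟩`. -/
def IsTypeOf (R : RootSystemBase V) (ℓ : ℕ) (α : ℕ → V) (M : ℕ → ℕ → ℝ) : Prop :=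
  Set.InjOn α (Set.Icc 1 ℓ) ∧ R.Δ0 = (Finset.Icc 1 ℓ).image α ∧
    ∀ i ∈ Finset.Icc 1 ℓ, ∀ j ∈ Finset.Icc 1 ℓ, cInt (α i) (α j) = M i j

/-- The Cartan matrix of type `Aₗ`. -/
def matA (i j : ℕ) : ℝ :=
  if i = j then 2 else if i + 1 = j ∨ j + 1 = i then -1 else 0

/-- The Cartan matrix of type `Bₗ` (with `α_ℓ` the short simple root). -/
def matB (ℓ i j : ℕ) : ℝ :=
  if i = j then 2
  else if i + 1 = j then (if j = ℓ then -2 else -1)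
  else if j + 1 = i then -1 else 0

/-- The Cartan matrix of type `Cₗ` (with `α_ℓ` the long simple root). -/
def matC (ℓ i j : ℕ) : ℝ :=
  if i = j then 2
  else if i + 1 = j then -1
  else if j + 1 = i then (if i = ℓ then -2 else -1) else 0

/-- The Cartan matrix of type `Dₗ`. -/
def matD (ℓ i j : ℕ) : ℝ :=
  if i = j then 2
  else if ((i + 1 = j ∨ j + 1 = i) ∧ ¬(i = ℓ - 1 ∧ j = ℓ) ∧ ¬(j = ℓ - 1 ∧ i = ℓ)) ∨
      (i = ℓ - 2 ∧ j = ℓ) ∨ (j = ℓ - 2 ∧ i = ℓ) then -1 else 0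

/-- The Cartan matrix of type `G₂` (with `α₁` the short simple root, Humphreys'
labelling). -/
def matG2 (i j : ℕ) : ℝ :=
  if i = j then 2 else if i = 1 ∧ j = 2 then -1 else if i = 2 ∧ j = 1 then -3 else 0

/-- The Cartan matrix of type `F₄` (Humphreys' labelling). -/
def matF4 (i j : ℕ) : ℝ :=
  if i = j then 2
  else if i = 2 ∧ j = 3 then -2
  else if i + 1 = j ∨ j + 1 = i then -1 else 0

/-- Adjacency in the Dynkin diagram of type `E_ℓ` (`ℓ = 6, 7, 8`), Humphreys'
labelling: the node `2` is attached to the node `4` of the chain `1,3,4,…,ℓ`. -/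
def eAdj (ℓ i j : ℕ) : Prop :=
  (min i j, max i j) ∈
    ([(1,3),(3,4),(4,5),(5,6),(2,4),(6,7),(7,8)].filter (fun p => p.2 ≤ ℓ))

/-- The Cartan matrix of type `E_ℓ` (`ℓ = 6, 7, 8`), Humphreys' labelling. -/
noncomputable def matE (ℓ i j : ℕ) : ℝ :=
  if i = j then 2 else if eAdj ℓ i j then -1 else 0

end RootSystemBase

/-- The root space decomposition data of a complex semisimple Lie algebra `L` with
root system `base`: a Cartan subalgebra `H`, one-dimensional root spaces `rs β`,
and the standard bracket relations among them. -/
structure GradedLieData (V : Type*) [NormedAddCommGroup V] [InnerProductSpace ℝ V]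
    (L : Type*) [LieRing L] [LieAlgebra ℂ L] where
  /-- the underlying root system with base -/
  base : RootSystemBase V
  /-- the Cartan subalgebra -/
  H : Submodule ℂ L
  /-- the root spaces -/
  rs : V → Submodule ℂ L
  rs_dim : ∀ β ∈ base.Δ, Module.finrank ℂ ↥(rs β) = 1
  rs_bot : ∀ v : V, v ∉ base.Δ → rs v = ⊥
  sup_eq_top : H ⊔ (⨆ β ∈ base.Δ, rs β) = ⊤
  h_indep : Disjoint H (⨆ β ∈ base.Δ, rs β)
  rs_indep : ∀ β ∈ base.Δ, Disjoint (rs β) (H ⊔ ⨆ γ ∈ base.Δ.erase β, rs γ)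
  /-- `toH v` is the element of the Cartan subalgebra representing `v` via the Killing
  form -/
  toH : V → L
  toH_mem : ∀ v : V, toH v ∈ H
  toH_add : ∀ u v : V, toH (u + v) = toH u + toH v
  H_span : H = Submodule.span ℂ (toH '' ↑base.Δ0)
  br_toH : ∀ v : V, ∀ β ∈ base.Δ, ∀ x ∈ rs β, ⁅toH v, x⁆ = ((⟪β, v⟫ : ℝ) : ℂ) • x
  br_h_h : ∀ h ∈ H, ∀ h' ∈ H, ⁅h, h'⁆ = (0 : L)
  br_h_rs : ∀ β ∈ base.Δ, ∀ h ∈ H, ∀ x ∈ rs β, ⁅h, x⁆ ∈ rs β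
  br_rs_mem : ∀ β ∈ base.Δ, ∀ γ ∈ base.Δ, β + γ ∈ base.Δ →
      ∀ x ∈ rs β, ∀ y ∈ rs γ, ⁅x, y⁆ ∈ rs (β + γ)
  br_rs_zero : ∀ β ∈ base.Δ, ∀ γ ∈ base.Δ, β + γ ∉ base.Δ → β + γ ≠ 0 →
      ∀ x ∈ rs β, ∀ y ∈ rs γ, ⁅x, y⁆ = (0 : L)
  br_rs_opp : ∀ β ∈ base.Δ, ∀ x ∈ rs β, ∀ y ∈ rs (-β),
      ⁅x, y⁆ ∈ Submodule.span ℂ ({toH β} : Set L)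
  br_nondeg : ∀ β ∈ base.Δ, ∀ γ ∈ base.Δ, β + γ ∈ base.Δ →
      ∀ x ∈ rs β, ∀ y ∈ rs γ, ⁅x, y⁆ = (0 : L) → x = 0 ∨ y = 0

namespace GradedLieData

variable {V : Type*} [NormedAddCommGroup V] [InnerProductSpace ℝ V]
variable {L : Type*} [LieRing L] [LieAlgebra ℂ L]

variable (G : GradedLieData V L)

/-- The grading component `𝔤ⱼ` of the grading of `L` determined by the subset `Sg`
of the simple roots. -/
def g (Sg : Finset V) (j : ℤ) : Submodule ℂ L :=
  if j = 0 then G.H ⊔ ⨆ β ∈ G.base.Δ.filter (fun β => G.base.ht Sg β = 0), G.rs β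
  else ⨆ β ∈ G.base.Δ.filter (fun β => G.base.ht Sg β = j), G.rs β

/-- The grading of `L` determined by `Sg` is of *Monge type*: the component `𝔤₋₁`
contains a nonzero abelian subalgebra `Y` of codimension one with
`dim 𝔤₋₂ = dim Y`. -/
def Monge (Sg : Finset V) : Prop :=
  ∃ Y : Submodule ℂ L, Y ≤ G.g Sg (-1) ∧ Y ≠ ⊥ ∧
    (∀ a ∈ Y, ∀ b ∈ Y, ⁅a, b⁆ = (0 : L)) ∧
    Module.finrank ℂ ↥Y + 1 = Module.finrank ℂ ↥(G.g Sg (-1)) ∧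
    Module.finrank ℂ ↥(G.g Sg (-2)) = Module.finrank ℂ ↥Y

end GradedLieData

namespace Exc
set_option linter.unusedSectionVars false
set_option linter.unusedVariables false

open RootSystemBase

variable {V : Type*} [NormedAddCommGroup V] [InnerProductSpace ℝ V]

/-- Linear combination of simple roots with integer coefficients. -/
noncomputable def toV {l : ℕ} (e : Fin l → V) (c : Fin l → ℤ) : V := ∑ i, (c i : ℝ) • e i

/-- Pairing of a coefficient vector with a simple coroot. -/
def pr {l : ℕ} (A : Fin l → Fin l → ℤ) (c : Fin l → ℤ) (j : Fin l) : ℤ := ∑ i, c i * A i j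

/-- Simple reflection on coefficient vectors. -/
def sr {l : ℕ} (A : Fin l → Fin l → ℤ) (j : Fin l) (c : Fin l → ℤ) : Fin l → ℤ :=
  c - (pr A c j) • (Pi.single j 1 : Fin l → ℤ)

/-- A root system base enumerated by `e` with integral Cartan matrix `A`. -/
structure Setup (R : RootSystemBase V) {l : ℕ} (e : Fin l → V) (A : Fin l → Fin l → ℤ) : Prop where
  inj : Function.Injective e
  base : R.Δ0 = Finset.univ.image e
  cart : ∀ i j, cInt (e i) (e j) = (A i j : ℝ)

variable {R : RootSystemBase V} {l : ℕ} {e : Fin l → V} {A : Fin l → Fin l → ℤ}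

theorem toV_single (e : Fin l → V) (j : Fin l) : toV e (Pi.single j 1) = e j := by
  unfold toV
  rw [Finset.sum_eq_single j]
  · simp
  · intro b _ hb; simp [hb]
  · simp

theorem toV_sub (e : Fin l → V) (c d : Fin l → ℤ) : toV e (c - d) = toV e c - toV e d := by
  simp [toV, sub_smul]

theorem toV_neg (e : Fin l → V) (c : Fin l → ℤ) : toV e (-c) = - toV e c := by
  simp [toV]

theorem toV_smul (e : Fin l → V) (k : ℤ) (c : Fin l → ℤ) : toV e (k • c) = (k : ℝ) • toV e c := by
  simp [toV, Finset.smul_sum, mul_smul]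

theorem Setup.mem0 (S : Setup R e A) (i : Fin l) : e i ∈ R.Δ0 := by
  rw [S.base]; simp

theorem Setup.mem (S : Setup R e A) (i : Fin l) : e i ∈ R.Δ := R.base_sub (S.mem0 i)

theorem Setup.linInd (S : Setup R e A) : LinearIndependent ℝ e := by
  have := R.indep.comp (fun i : Fin l => (⟨e i, S.mem0 i⟩ : R.Δ0))
    (fun i j h => S.inj (by simpa using h))
  exact this

theorem Setup.toV_inj (S : Setup R e A) : Function.Injective (toV e) := by
  intro c d h
  have h2 : ∑ i, ((c i : ℝ) - d i) • e i = 0 := by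
    have : toV e c - toV e d = 0 := sub_eq_zero.2 h
    simpa [toV, sub_smul] using this
  have := Fintype.linearIndependent_iff.1 S.linInd _ h2
  funext i
  have := this i
  have h3 : (c i : ℝ) = d i := by linarith
  exact_mod_cast h3

/-- coefficient vector -/
def cv (R : RootSystemBase V) (e : Fin l → V) (β : V) : Fin l → ℤ := fun i => R.coeff β (e i)

theorem Setup.toV_cv (S : Setup R e A) {β : V} (h : β ∈ R.Δ) : toV e (cv R e β) = β := by
  conv_rhs => rw [R.coeff_spec β h, S.base]
  rw [Finset.sum_image (fun a _ b _ h => S.inj h)]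
  rfl

theorem Setup.cv_toV (S : Setup R e A) {c : Fin l → ℤ} (h : toV e c ∈ R.Δ) :
    cv R e (toV e c) = c := S.toV_inj (S.toV_cv h)

theorem Setup.forall0 (S : Setup R e A) {p : V → Prop} : (∀ a ∈ R.Δ0, p a) ↔ ∀ i, p (e i) := by
  rw [S.base]; simp

theorem cInt_toV (S : Setup R e A) (c : Fin l → ℤ) (j : Fin l) :
    cInt (toV e c) (e j) = (pr A c j : ℝ) := by
  have h : cInt (toV e c) (e j) = ∑ i, (c i : ℝ) * cInt (e i) (e j) := by
    unfold cInt toV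
    rw [sum_inner, Finset.mul_sum, Finset.sum_div]
    refine Finset.sum_congr rfl fun i _ => ?_
    rw [real_inner_smul_left]; ring
  rw [h]; simp [pr, S.cart]

theorem refl_toV (S : Setup R e A) (c : Fin l → ℤ) (j : Fin l) :
    refl (e j) (toV e c) = toV e (sr A j c) := by
  unfold RootSystemBase.refl sr
  rw [cInt_toV S, toV_sub, toV_smul, toV_single]

theorem Setup.sr_mem (S : Setup R e A) {c : Fin l → ℤ} (h : toV e c ∈ R.Δ) (j : Fin l) :
    toV e (sr A j c) ∈ R.Δ := by
  rw [← refl_toV S]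
  exact R.reflect_mem _ (S.mem j) _ h

theorem Setup.diag (S : Setup R e A) (i : Fin l) : A i i = 2 := by
  have h := S.cart i i
  unfold cInt at h
  have h0 : ⟪e i, e i⟫ ≠ 0 := by
    rw [inner_self_ne_zero]; exact R.ne_zero _ (S.mem i)
  rw [mul_div_assoc, div_self h0] at h
  have : (A i i : ℝ) = 2 := by linarith
  exact_mod_cast this

theorem pr_single (A : Fin l → Fin l → ℤ) (i j : Fin l) : pr A (Pi.single i 1) j = A i j := by
  unfold pr
  rw [Finset.sum_eq_single i]
  · simp
  · intro b _ hb; simp [hb]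
  · simp

theorem pr_sub_smul (A : Fin l → Fin l → ℤ) (c : Fin l → ℤ) (k : ℤ) (i j : Fin l) :
    pr A (c - k • (Pi.single i 1 : Fin l → ℤ)) j = pr A c j - k * A i j := by
  rw [← pr_single A i j]
  unfold pr
  rw [Finset.mul_sum, ← Finset.sum_sub_distrib]
  refine Finset.sum_congr rfl fun x _ => ?_
  simp only [Pi.sub_apply, Pi.smul_apply, smul_eq_mul]; ring

theorem Setup.pr_sr (S : Setup R e A) (c : Fin l → ℤ) (j : Fin l) :
    pr A (sr A j c) j = - pr A c j := by
  unfold sr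
  rw [pr_sub_smul, S.diag]; ring

theorem Setup.sr_sr (S : Setup R e A) (c : Fin l → ℤ) (j : Fin l) : sr A j (sr A j c) = c := by
  conv_lhs => unfold sr
  rw [show c - pr A c j • (Pi.single j 1 : Fin l → ℤ) = sr A j c from rfl, S.pr_sr]
  unfold sr; simp

theorem Setup.sign (S : Setup R e A) {c : Fin l → ℤ} (h : toV e c ∈ R.Δ) : 0 ≤ c ∨ c ≤ 0 := by
  have := R.coeff_sign _ h
  rw [S.forall0, S.forall0] at this
  have h2 := S.cv_toV h
  rw [← h2]
  exact this

theorem Setup.isPos (S : Setup R e A) (c : Fin l → ℤ) :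
    R.IsPos (toV e c) ↔ toV e c ∈ R.Δ ∧ 0 ≤ c := by
  unfold IsPos
  refine and_congr_right fun h => ?_
  rw [S.forall0]
  conv_rhs => rw [← S.cv_toV h]
  rfl

theorem Setup.isNeg (S : Setup R e A) (c : Fin l → ℤ) :
    R.IsNeg (toV e c) ↔ toV e c ∈ R.Δ ∧ c ≤ 0 := by
  unfold IsNeg
  refine and_congr_right fun h => ?_
  rw [S.forall0]
  conv_rhs => rw [← S.cv_toV h]
  rfl

theorem Setup.pos_pair (S : Setup R e A) {c : Fin l → ℤ} (h : toV e c ∈ R.Δ) (h0 : 0 ≤ c) :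
    ∃ j, 0 < pr A c j := by
  by_contra hcon
  push Not at hcon
  have h1 : 0 < ⟪toV e c, toV e c⟫ := by
    rw [real_inner_self_pos]; exact R.ne_zero _ h
  have h2 : ⟪toV e c, toV e c⟫ = ∑ j, (c j : ℝ) * ⟪toV e c, e j⟫ := by
    conv_lhs => rw [show toV e c = ∑ i, (c i : ℝ) • e i from rfl]
    rw [inner_sum]
    refine Finset.sum_congr rfl fun i _ => ?_
    rw [real_inner_smul_right]; rfl
  have h3 : ∑ j, (c j : ℝ) * ⟪toV e c, e j⟫ ≤ 0 := by
    refine Finset.sum_nonpos fun j _ => ?_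
    have hj := hcon j
    have hp : 0 < ⟪e j, e j⟫ := by rw [real_inner_self_pos]; exact R.ne_zero _ (S.mem j)
    have h4 := cInt_toV S c j
    unfold cInt at h4
    rw [div_eq_iff hp.ne'] at h4
    have h5 : (pr A c j : ℝ) ≤ 0 := by exact_mod_cast hj
    have h6 : ⟪toV e c, e j⟫ ≤ 0 := by nlinarith
    have h7 : (0:ℝ) ≤ c j := by exact_mod_cast h0 j
    exact mul_nonpos_of_nonneg_of_nonpos h7 h6
  linarith

theorem Setup.smul_single (S : Setup R e A) {k : ℤ} {j : Fin l} (hk : 0 < k)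
    (h : toV e (k • (Pi.single j 1 : Fin l → ℤ)) ∈ R.Δ) : k = 1 := by
  rw [toV_smul, toV_single] at h
  obtain ⟨m, hm⟩ := R.crystal _ h _ (S.mem j)
  have hp : 0 < ⟪e j, e j⟫ := by rw [real_inner_self_pos]; exact R.ne_zero _ (S.mem j)
  have hkr : (0:ℝ) < k := by exact_mod_cast hk
  rw [real_inner_smul_left, real_inner_smul_right,
    div_eq_iff (by positivity)] at hm
  have h2 : (2 : ℝ) = m * k := by
    have : (k * ⟪e j, e j⟫) * 2 = (k * ⟪e j, e j⟫) * (m * k) := by linarith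
    exact mul_left_cancel₀ (by positivity) this
  have h3 : (2 : ℤ) = m * k := by exact_mod_cast h2
  have h4 : k ∣ 2 := ⟨m, by rw [h3]; ring⟩
  have h5 := Int.le_of_dvd (by norm_num) h4
  have h6 : k = 1 ∨ k = 2 := by omega
  rcases h6 with h6 | h6
  · exact h6
  · exfalso
    subst h6
    exact R.reduced _ (S.mem j) (by simpa using h)

theorem Setup.pos_mem (S : Setup R e A) (P : Set (Fin l → ℤ))
    (hs : ∀ j, Pi.single j 1 ∈ P)
    (hup : ∀ c ∈ P, ∀ j, pr A c j < 0 → sr A j c ∈ P)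
    {c : Fin l → ℤ} (h : toV e c ∈ R.Δ) (h0 : 0 ≤ c) : c ∈ P := by
  obtain ⟨n, hn⟩ : ∃ n : ℕ, ∑ i, c i = n :=
    ⟨(∑ i, c i).toNat, (Int.toNat_of_nonneg (Finset.sum_nonneg fun i _ => h0 i)).symm⟩
  induction n using Nat.strong_induction_on generalizing c with
  | _ n ih =>
  obtain ⟨j, hj⟩ := S.pos_pair h h0
  have hm := S.sr_mem h j
  rcases S.sign hm with hp | hp
  · have hsum : ∑ i, (sr A j c) i = n - pr A c j := by
      unfold sr
      simp only [Pi.sub_apply, Pi.smul_apply, smul_eq_mul, Finset.sum_sub_distrib, hn,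
        ← Finset.mul_sum]
      simp
    have hnn : 0 ≤ ∑ i, (sr A j c) i := Finset.sum_nonneg fun i _ => hp i
    have := ih (n - pr A c j).toNat (by omega) hm hp (by omega)
    have h2 := hup _ this j (by rw [S.pr_sr]; omega)
    rwa [S.sr_sr] at h2
  · have hc : c = (c j) • (Pi.single j 1 : Fin l → ℤ) := by
      funext i
      by_cases hij : i = j
      · subst hij; simp
      · have h1 := hp i
        have h2 := h0 i
        simp [sr, hij] at h1 h2 ⊢
        omega
    have hcj : 0 < c j := by
      rcases (h0 j).lt_or_eq with h1 | h1
      · exact h1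
      · exfalso
        rw [← h1] at hc
        apply R.ne_zero _ h
        rw [hc]; simp [toV]
    have h1 : c j = 1 := by
      apply S.smul_single hcj (j := j)
      rw [← hc]; exact h
    rw [hc, h1, one_smul]; exact hs j

theorem Setup.neg_mem (S : Setup R e A) {c : Fin l → ℤ} (h : toV e c ∈ R.Δ) :
    toV e (-c) ∈ R.Δ := by
  rw [toV_neg]; exact R.neg_mem _ h

/-- Height of a coefficient vector relative to a subset. -/
noncomputable def hv (e : Fin l → V) (Sg : Finset V) (c : Fin l → ℤ) : ℤ :=
  ∑ i, (if e i ∈ Sg then 1 else 0) * c i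

theorem Setup.ht_toV (S : Setup R e A) {Sg : Finset V} (hSg : Sg ⊆ R.Δ0) {c : Fin l → ℤ}
    (h : toV e c ∈ R.Δ) : R.ht Sg (toV e c) = hv e Sg c := by
  unfold ht hv
  have h1 : Sg = (Finset.univ.filter (fun i => e i ∈ Sg)).image e := by
    ext v
    simp only [Finset.mem_image, Finset.mem_filter, Finset.mem_univ, true_and]
    constructor
    · intro hv
      have := hSg hv
      rw [S.base] at this
      simp only [Finset.mem_image, Finset.mem_univ, true_and] at this
      obtain ⟨i, rfl⟩ := this
      exact ⟨i, hv, rfl⟩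
    · rintro ⟨i, hi, rfl⟩; exact hi
  have h2 : ∀ i, R.coeff (toV e c) (e i) = c i := fun i => congrFun (S.cv_toV h) i
  conv_lhs => rw [h1]
  rw [Finset.sum_image (fun a _ b _ h => S.inj h), Finset.sum_filter]
  refine Finset.sum_congr rfl fun i _ => ?_
  rw [h2]; split_ifs <;> simp

theorem hv_neg (e : Fin l → V) (Sg : Finset V) (c : Fin l → ℤ) : hv e Sg (-c) = - hv e Sg c := by
  simp [hv]

theorem hv_nonneg (e : Fin l → V) (Sg : Finset V) {c : Fin l → ℤ} (h : 0 ≤ c) :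
    0 ≤ hv e Sg c := by
  refine Finset.sum_nonneg fun i _ => ?_
  have := h i
  simp only [Pi.zero_apply] at this
  split_ifs <;> simp [this]

theorem hv_single (e : Fin l → V) (Sg : Finset V) (j : Fin l) :
    hv e Sg (Pi.single j 1) = if e j ∈ Sg then 1 else 0 := by
  unfold hv
  rw [Finset.sum_eq_single j]
  · simp
  · intro b _ hb; simp [hb]
  · simp

/-- Complete description of the positive roots by a finset. -/
structure PosRoots (R : RootSystemBase V) (e : Fin l → V) (P : Finset (Fin l → ℤ)) : Prop where
  root : ∀ c ∈ P, toV e c ∈ R.Δ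
  nonneg : ∀ c ∈ P, 0 ≤ c
  all : ∀ c, toV e c ∈ R.Δ → 0 ≤ c → c ∈ P

theorem card_ht (S : Setup R e A) {P : Finset (Fin l → ℤ)} (hP : PosRoots R e P)
    {Sg : Finset V} (hSg : Sg ⊆ R.Δ0) (k : ℤ) (hk : 0 < k) :
    (R.Δ.filter (fun β => R.ht Sg β = -k)).card = (P.filter (fun c => hv e Sg c = k)).card := by
  symm
  refine Finset.card_bij (fun c _ => toV e (-c)) ?_ ?_ ?_
  · intro c hc
    rw [Finset.mem_filter] at hc ⊢
    have h1 := S.neg_mem (hP.root c hc.1)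
    exact ⟨h1, by rw [S.ht_toV hSg h1, hv_neg, hc.2]⟩
  · intro c _ d _ h
    exact neg_injective (S.toV_inj h)
  · intro β hβ
    rw [Finset.mem_filter] at hβ
    have h1 := S.toV_cv hβ.1
    set c := cv R e β
    have hm : toV e c ∈ R.Δ := by rw [h1]; exact hβ.1
    have h2 := hβ.2
    rw [← h1, S.ht_toV hSg hm] at h2
    refine ⟨-c, ?_, by simpa using h1⟩
    rw [Finset.mem_filter]
    refine ⟨hP.all _ (S.neg_mem hm) ?_, by rw [hv_neg, h2]; ring⟩
    rcases S.sign hm with h | h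
    · have := hv_nonneg e Sg h; omega
    · intro i; have := h i; simp at this ⊢; omega

section Lie
variable {L : Type*} [LieRing L] [LieAlgebra ℂ L] [FiniteDimensional ℂ L]

theorem finrank_iSup (G : GradedLieData V L) (S : Finset V) (hS : S ⊆ G.base.Δ) :
    Module.finrank ℂ ↥(⨆ β ∈ S, G.rs β) = S.card := by
  induction S using Finset.induction_on with
  | empty => simp
  | insert a S ha ih =>
    rw [Finset.iSup_insert, Finset.card_insert_of_notMem ha]
    have hS' : S ⊆ G.base.Δ := fun x hx => hS (Finset.mem_insert_of_mem hx)
    have haΔ : a ∈ G.base.Δ := hS (Finset.mem_insert_self _ _)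
    have hd : Disjoint (G.rs a) (⨆ β ∈ S, G.rs β) := by
      refine (G.rs_indep a haΔ).mono_right (le_sup_of_le_right ?_)
      refine biSup_mono fun β hβ => ?_
      rw [Finset.mem_erase]
      exact ⟨fun h => ha (h ▸ hβ), hS' hβ⟩
    have := Submodule.finrank_sup_add_finrank_inf_eq (G.rs a) (⨆ β ∈ S, G.rs β)
    rw [hd.eq_bot, finrank_bot, ih hS', G.rs_dim a haΔ] at this
    omega

theorem finrank_g (G : GradedLieData V L) (S : Setup G.base e A) {P : Finset (Fin l → ℤ)}
    (hP : PosRoots G.base e P) {Sg : Finset V} (hSg : Sg ⊆ G.base.Δ0) (k : ℤ) (hk : 0 < k) :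
    Module.finrank ℂ ↥(G.g Sg (-k)) = (P.filter (fun c => hv e Sg c = k)).card := by
  rw [← card_ht S hP hSg k hk]
  unfold GradedLieData.g
  rw [if_neg (by omega)]
  exact finrank_iSup G _ (Finset.filter_subset _ _)

end Lie

/-- Consequences of non-rigidity. -/
theorem nonRigid_imp (S : Setup R e A) (hA : ∀ i j, i ≠ j → A i j ≤ 0) {t : Fin l → ℤ}
    (ht : toV e t ∈ R.Δ) {Sg : Finset V} (hSg : Sg ⊆ R.Δ0) (h : R.NonRigid Sg (toV e t)) :
    ∃ a b : Fin l, a ≠ b ∧ e a ∈ Sg ∧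
      hv e Sg t ≤ pr A t a + (pr A t b + 1) *
        ((if e b ∈ Sg then 1 else 0) - A b a * (if e a ∈ Sg then 1 else 0)) := by
  obtain ⟨a', ha', b', hb', hab, -, hpos, hle⟩ := h
  rw [S.base] at ha' hb'
  simp only [Finset.mem_image, Finset.mem_univ, true_and] at ha' hb'
  obtain ⟨a, rfl⟩ := ha'
  obtain ⟨b, rfl⟩ := hb'
  have hab' : a ≠ b := fun h => hab (by rw [h])
  have hsa : toV e (Pi.single a 1) ∈ R.Δ := by rw [toV_single]; exact S.mem a
  have hsb : toV e (Pi.single b 1) ∈ R.Δ := by rw [toV_single]; exact S.mem b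
  have hra := S.sr_mem hsa a
  refine ⟨a, b, hab', ?_, ?_⟩
  · have hmem : e a ∈ R.Dsig (e a) (e b) := by
      unfold Dsig
      rw [Finset.mem_filter]
      refine ⟨S.mem a, ?_, ?_⟩
      · rw [← toV_single e a, S.isPos]
        exact ⟨hsa, by intro i; by_cases h : i = a <;> simp [h]⟩
      · rw [← toV_single e a, toV_single e a]
        conv => arg 2; rw [← toV_single e a, toV_single e a]
        have : refl (e b) (refl (e a) (e a)) = toV e (sr A b (sr A a (Pi.single a 1))) := by
          rw [← refl_toV S, ← refl_toV S, toV_single]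
        rw [this, S.isNeg]
        refine ⟨S.sr_mem hra b, ?_⟩
        unfold sr
        rw [pr_single, S.diag]
        intro i
        have h1 := hA a b hab'
        rw [pr_sub_smul, pr_single]
        simp only [Pi.sub_apply, Pi.smul_apply, Pi.single_apply, smul_eq_mul, Pi.zero_apply]
        by_cases hia : i = a
        · have : i ≠ b := fun h => hab' (hia ▸ h)
          simp [hia, hab']
        · by_cases hib : i = b
          · simp [hib, hab'.symm]; omega
          · simp [hia, hib]
    have := hpos _ hmem
    rw [← toV_single e a, S.ht_toV hSg hsa, hv_single] at this
    by_contra hcon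
    rw [if_neg hcon] at this
    exact lt_irrefl _ this
  · have h1 : refl (e a) (e b) = toV e (sr A a (Pi.single b 1)) := by
      rw [← refl_toV S, toV_single]
    have h2 : hv e Sg (sr A a (Pi.single b 1)) =
        ((if e b ∈ Sg then 1 else 0) - A b a * (if e a ∈ Sg then 1 else 0)) := by
      rw [← hv_single e Sg a, ← hv_single e Sg b, sr, pr_single]
      unfold hv
      rw [Finset.mul_sum, ← Finset.sum_sub_distrib]
      refine Finset.sum_congr rfl fun i _ => ?_
      simp only [Pi.sub_apply, Pi.smul_apply, smul_eq_mul]; ring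
    rw [h1, S.ht_toV hSg (S.sr_mem hsb a), S.ht_toV hSg ht, cInt_toV S, cInt_toV S, h2] at hle
    exact_mod_cast hle


/-- Dot product of lists of naturals. -/
def dot : List ℕ → List ℕ → ℕ
  | a :: s, b :: t => a * b + dot s t
  | _, _ => 0

theorem dot_eq : ∀ (n : ℕ) (s t : List ℕ), s.length = n → t.length = n →
    dot s t = ∑ i : Fin n, s.getD i 0 * t.getD i 0
  | 0, s, t, _, _ => by cases s <;> cases t <;> simp_all [dot]
  | n + 1, [], t, h, _ => by simp at h
  | n + 1, _ :: _, [], _, h => by simp at h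
  | n + 1, a :: s, b :: t, hs, ht => by
    rw [Fin.sum_univ_succ, dot, dot_eq n s t (by simpa using hs) (by simpa using ht)]
    simp

/-- The coefficient vector of a list. -/
def fl (l : ℕ) (c : List ℕ) : Fin l → ℤ := fun i => ((c.getD i 0 : ℕ) : ℤ)

/-- The Cartan matrix encoded by the table `K`: row `j` lists the numbers `-⟨αᵢ, αⱼ⟩`,
with zero on the diagonal. -/
def LA (l : ℕ) (K : List (List ℕ)) (i j : Fin l) : ℤ :=
  if i = j then 2 else -(((K.getD j []).getD i 0 : ℕ) : ℤ)

/-- Unit vector. -/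
def unitL (l j : ℕ) : List ℕ := (List.replicate l 0).set j 1

/-- Reflection of lists. -/
def rfL (K : List (List ℕ)) (c : List ℕ) (j : ℕ) : List ℕ :=
  c.set j (dot (K.getD j []) c - c.getD j 0)

/-- Check of the table `K`. -/
def OkK (l : ℕ) (K : List (List ℕ)) : Prop :=
  ∀ j < l, (K.getD j []).length = l ∧ (K.getD j []).getD j 0 = 0

/-- Check of the list of positive roots. -/
structure OkP (l : ℕ) (K P : List (List ℕ)) : Prop where
  len : ∀ c ∈ P, c.length = l
  unit : ∀ j < l, unitL l j ∈ P
  up : ∀ c ∈ P, ∀ j < l, 2 * c.getD j 0 < dot (K.getD j []) c → rfL K c j ∈ P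
  down : ∀ c ∈ P, ∃ j < l, c = unitL l j ∨ (dot (K.getD j []) c < 2 * c.getD j 0 ∧
    c.getD j 0 ≤ dot (K.getD j []) c ∧ rfL K c j ∈ P)
  nodup : P.Nodup

theorem fl_unit (j : Fin l) : fl l (unitL l j) = Pi.single j 1 := by
  funext i
  by_cases h : i = j
  · subst h
    simp [fl, unitL, List.getD_eq_getElem?_getD]
  · have h' : (j : ℕ) ≠ i := fun h2 => h (Fin.ext h2.symm)
    simp [fl, unitL, List.getD_eq_getElem?_getD, h, List.getElem_set_ne h']

theorem fl_nonneg (c : List ℕ) : 0 ≤ fl l c := fun i => by simp [fl]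

theorem fl_inj {c d : List ℕ} (hc : c.length = l) (hd : d.length = l) (h : fl l c = fl l d) :
    c = d := by
  apply List.ext_getElem (by rw [hc, hd])
  intro i h1 h2
  have := congrFun h ⟨i, hc ▸ h1⟩
  simpa [fl, List.getD_eq_getElem?_getD, h1, h2] using this

theorem pr_fl {K : List (List ℕ)} (hK : OkK l K) {c : List ℕ} (hc : c.length = l) (j : Fin l) :
    pr (LA l K) (fl l c) j = 2 * (c.getD j 0 : ℕ) - (dot (K.getD j []) c : ℕ) := by
  obtain ⟨h1, h2⟩ := hK j j.2
  rw [dot_eq l _ _ h1 hc]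
  unfold pr
  have h3 : (2 * (c.getD j 0 : ℕ) : ℤ) = ∑ i : Fin l, if i = j then 2 * ((c.getD i 0 : ℕ) : ℤ) else 0 := by
    simp
  rw [h3]
  push_cast
  rw [← Finset.sum_sub_distrib]
  refine Finset.sum_congr rfl fun i _ => ?_
  by_cases hij : i = j
  · subst hij
    simp only [LA, fl, if_true, h2]; ring
  · simp only [LA, fl, hij, if_false]; ring

theorem sr_fl {K : List (List ℕ)} (hK : OkK l K) {c : List ℕ} (hc : c.length = l) (j : Fin l)
    (hle : c.getD j 0 ≤ dot (K.getD j []) c) :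
    sr (LA l K) j (fl l c) = fl l (rfL K c j) := by
  unfold sr
  rw [pr_fl hK hc]
  funext i
  by_cases h : i = j
  · subst h
    have h1 : fl l (rfL K c i) i = ((dot (K.getD i []) c - c.getD i 0 : ℕ) : ℤ) := by
      simp [fl, rfL, List.getD_eq_getElem?_getD, hc]
    rw [h1]
    push_cast [hle]
    simp only [Pi.sub_apply, Pi.smul_apply, Pi.single_eq_same, smul_eq_mul, fl]
    ring
  · have h' : (j : ℕ) ≠ i := fun h2 => h (Fin.ext h2.symm)
    simp [fl, rfL, List.getD_eq_getElem?_getD, h, List.getElem?_set_ne h']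

/-- The finset of positive roots. -/
def PF (l : ℕ) (P : List (List ℕ)) : Finset (Fin l → ℤ) := (P.map (fl l)).toFinset

theorem root_of_ok {K P : List (List ℕ)} (S : Setup R e (LA l K)) (hK : OkK l K) (hP : OkP l K P) :
    ∀ (n : ℕ), ∀ c ∈ P, ∑ i, fl l c i = n → toV e (fl l c) ∈ R.Δ := by
  intro n
  induction n using Nat.strong_induction_on with
  | _ n ih =>
  intro c hc hn
  obtain ⟨j, hj, h⟩ := hP.down c hc
  rcases h with h | ⟨h1, h2, h3⟩
  · rw [h, fl_unit ⟨j, hj⟩, toV_single]; exact S.mem _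
  · have hs := sr_fl hK (hP.len c hc) ⟨j, hj⟩ h2
    have hpr := pr_fl hK (hP.len c hc) ⟨j, hj⟩
    simp only at hs hpr
    have hsum : ∑ i, (fl l (rfL K c j)) i = n - pr (LA l K) (fl l c) ⟨j, hj⟩ := by
      rw [← hs]
      unfold sr
      simp only [Pi.sub_apply, Pi.smul_apply, smul_eq_mul, Finset.sum_sub_distrib, hn,
        ← Finset.mul_sum]
      simp
    have hnn : 0 ≤ ∑ i, (fl l (rfL K c j)) i := Finset.sum_nonneg fun i _ => fl_nonneg _ i
    have := ih (n - pr (LA l K) (fl l c) ⟨j, hj⟩).toNat (by omega) _ h3 (by omega)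
    rw [← hs] at this
    have h4 := S.sr_mem this ⟨j, hj⟩
    rwa [S.sr_sr] at h4

theorem posRoots_of_ok {K P : List (List ℕ)} (S : Setup R e (LA l K)) (hK : OkK l K)
    (hP : OkP l K P) : PosRoots R e (PF l P) where
  root c hc := by
    simp only [PF, List.mem_toFinset, List.mem_map] at hc
    obtain ⟨c, hc, rfl⟩ := hc
    exact root_of_ok S hK hP (∑ i, fl l c i).toNat c hc
      (Int.toNat_of_nonneg (Finset.sum_nonneg fun i _ => fl_nonneg _ i)).symm
  nonneg c hc := by
    simp only [PF, List.mem_toFinset, List.mem_map] at hc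
    obtain ⟨c, hc, rfl⟩ := hc
    exact fl_nonneg c
  all c h h0 := by
    refine S.pos_mem (↑(PF l P)) ?_ ?_ h h0
    · intro j
      simp only [PF, Finset.mem_coe, List.mem_toFinset, List.mem_map]
      exact ⟨_, hP.unit j j.2, fl_unit j⟩
    · intro c hc j hj
      simp only [PF, Finset.mem_coe, List.mem_toFinset, List.mem_map] at hc ⊢
      obtain ⟨c, hc, rfl⟩ := hc
      rw [pr_fl hK (hP.len c hc)] at hj
      refine ⟨_, hP.up c hc j j.2 (by omega), ?_⟩
      rw [sr_fl hK (hP.len c hc)]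
      omega

/-- The 0/1 list of a subset of the simple roots. -/
noncomputable def mask (e : Fin l → V) (Sg : Finset V) : List ℕ :=
  List.ofFn (fun i => if e i ∈ Sg then 1 else 0)

theorem mask_length (e : Fin l → V) (Sg : Finset V) : (mask e Sg).length = l := by simp [mask]

theorem mask_getD (e : Fin l → V) (Sg : Finset V) (i : Fin l) :
    (mask e Sg).getD i 0 = if e i ∈ Sg then 1 else 0 := by
  simp [mask, List.getD_eq_getElem?_getD]

theorem hv_fl (e : Fin l → V) (Sg : Finset V) {c : List ℕ} (hc : c.length = l) :
    hv e Sg (fl l c) = (dot (mask e Sg) c : ℕ) := by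
  rw [dot_eq l _ _ (mask_length e Sg) hc]
  unfold hv
  push_cast
  refine Finset.sum_congr rfl fun i _ => ?_
  rw [mask_getD]
  simp [fl]

/-- Number of roots of height `k`. -/
def cnt (P : List (List ℕ)) (s : List ℕ) (k : ℕ) : ℕ := P.countP (fun c => Nat.beq (dot s c) k)

theorem card_PF {K P : List (List ℕ)} (hP : OkP l K P) (e : Fin l → V) (Sg : Finset V) (k : ℕ) :
    ((PF l P).filter (fun c => hv e Sg c = (k : ℤ))).card = cnt P (mask e Sg) k := by
  unfold PF cnt
  have hf : (P.map (fl l)).toFinset.filter (fun c => hv e Sg c = (k : ℤ)) =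
      ((P.map (fl l)).filter (fun c => decide (hv e Sg c = (k : ℤ)))).toFinset := by
    ext c; simp
  rw [hf, List.toFinset_card_of_nodup, ← List.countP_eq_length_filter,
    List.countP_map]
  · refine List.countP_congr fun c hc => ?_
    simp [hv_fl e Sg (hP.len c hc)]
  · refine List.Nodup.filter _ ?_
    exact List.Nodup.map_on (fun x hx y hy h => fl_inj (hP.len x hx) (hP.len y hy) h) hP.nodup

/-- Check of a predicate on all 0/1 lists of length `n`. -/
def allMask : ℕ → (List ℕ → Bool) → Bool
  | 0, p => p []
  | n + 1, p => allMask n (fun t => p (0 :: t)) && allMask n (fun t => p (1 :: t))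

theorem allMask_spec : ∀ (n : ℕ) (p : List ℕ → Bool), allMask n p = true →
    ∀ s : List ℕ, s.length = n → (∀ x ∈ s, x = 0 ∨ x = 1) → p s = true
  | 0, p, h, s, hs, _ => by
    rw [List.length_eq_zero_iff] at hs; subst hs; exact h
  | n + 1, p, h, [], hs, _ => by simp at hs
  | n + 1, p, h, x :: s, hs, hx => by
    simp only [allMask, Bool.and_eq_true] at h
    have h1 : s.length = n := by simpa using hs
    have h2 : ∀ y ∈ s, y = 0 ∨ y = 1 := fun y hy => hx y (List.mem_cons_of_mem _ hy)
    rcases hx x List.mem_cons_self with rfl | rfl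
    · exact allMask_spec n _ h.1 s h1 h2
    · exact allMask_spec n _ h.2 s h1 h2

/-- Necessary condition for non-rigidity. -/
def nrC (l : ℕ) (K : List (List ℕ)) (t q s : List ℕ) : Bool :=
  (List.range l).any fun a => Nat.beq (s.getD a 0) 1 && (List.range l).any fun b =>
    !(Nat.beq a b) && Nat.ble (dot s t)
      (q.getD a 0 + (q.getD b 0 + 1) * (s.getD b 0 + (K.getD a []).getD b 0))

/-- Highest root check. -/
structure OkT (l : ℕ) (K P : List (List ℕ)) (t q : List ℕ) : Prop where
  mem : t ∈ P
  top : ∀ c ∈ P, ∀ i < l, c.getD i 0 ≤ t.getD i 0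
  dom : ∀ i < l, dot (K.getD i []) t + q.getD i 0 = 2 * t.getD i 0

theorem highest_eq {K P : List (List ℕ)} {t q : List ℕ} (S : Setup R e (LA l K)) (hK : OkK l K)
    (hP : OkP l K P) (hT : OkT l K P t q) {θ : V} (hθ : R.IsHighest θ) : θ = toV e (fl l t) := by
  obtain ⟨h1, h2⟩ := hθ
  have hR := posRoots_of_ok S hK hP
  have ht : toV e (fl l t) ∈ R.Δ := hR.root _ (by
    simp only [PF, List.mem_toFinset, List.mem_map]; exact ⟨t, hT.mem, rfl⟩)
  have h3 : fl l t ≤ cv R e θ := by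
    intro i
    have := h2 _ ht (e i) (S.mem0 i)
    have h4 := congrFun (S.cv_toV ht) i
    rw [← h4]; exact this
  have h5 : cv R e θ ∈ PF l P := hR.all _ (by rw [S.toV_cv h1]; exact h1) ((fl_nonneg t).trans h3)
  simp only [PF, List.mem_toFinset, List.mem_map] at h5
  obtain ⟨c, hc, hcv⟩ := h5
  rw [← S.toV_cv h1]
  congr 1
  refine le_antisymm ?_ h3
  rw [← hcv]
  intro i
  have := hT.top c hc i i.2
  simp only [fl]; exact_mod_cast this

theorem main_check {L : Type*} [LieRing L] [LieAlgebra ℂ L] [FiniteDimensional ℂ L]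
    (G : GradedLieData V L) {K P : List (List ℕ)} {t q : List ℕ} (S : Setup G.base e (LA l K))
    (hK : OkK l K) (hP : OkP l K P) (hT : OkT l K P t q) {Sg : Finset V} (hSg : Sg ⊆ G.base.Δ0)
    {θ : V} (hθ : G.base.IsHighest θ) (good : List ℕ → Bool)
    (hc : allMask l (fun s => !(nrC l K t q s) ||
      !(Nat.beq (cnt P s 1) (cnt P s 2 + 1)) || good s) = true)
    (hM : G.Monge Sg) (hN : G.base.NonRigid Sg θ) : good (mask e Sg) = true := by
  have hR := posRoots_of_ok S hK hP
  have h1 := allMask_spec _ _ hc (mask e Sg) (mask_length e Sg) (by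
    intro x hx
    simp only [mask, List.mem_ofFn] at hx
    obtain ⟨i, rfl⟩ := hx
    split_ifs <;> simp)
  obtain ⟨Y, -, -, -, hY1, hY2⟩ := hM
  rw [finrank_g G S hR hSg 1 (by norm_num)] at hY1
  rw [finrank_g G S hR hSg 2 (by norm_num)] at hY2
  have c1 := card_PF hP e Sg 1
  have c2 := card_PF hP e Sg 2
  push_cast at c1 c2
  rw [c1] at hY1
  rw [c2] at hY2
  have h2 : Nat.beq (cnt P (mask e Sg) 1) (cnt P (mask e Sg) 2 + 1) = true := by
    rw [Nat.beq_eq]; omega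
  have ht : toV e (fl l t) ∈ G.base.Δ := hR.root _ (by
    simp only [PF, List.mem_toFinset, List.mem_map]; exact ⟨t, hT.mem, rfl⟩)
  rw [highest_eq S hK hP hT hθ] at hN
  obtain ⟨a, b, hab, ha, hle⟩ := nonRigid_imp S (by
    intro i j hij; simp [LA, hij]) ht hSg hN
  have h3 : nrC l K t q (mask e Sg) = true := by
    have htl := hP.len t hT.mem
    rw [hv_fl e Sg htl, pr_fl hK htl, pr_fl hK htl] at hle
    have d1 := hT.dom a a.2
    have d2 := hT.dom b b.2
    unfold nrC
    rw [List.any_eq_true]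
    refine ⟨a, by simp, ?_⟩
    rw [mask_getD, if_pos ha, Bool.and_eq_true]
    refine ⟨rfl, ?_⟩
    rw [List.any_eq_true]
    refine ⟨b, by simp, ?_⟩
    have hab' : (a : ℕ) ≠ b := fun h => hab (Fin.ext h)
    rw [Bool.and_eq_true]
    refine ⟨?_, ?_⟩
    · rw [Bool.not_eq_true']
      rw [Bool.eq_false_iff, ne_eq, Nat.beq_eq]; exact hab'
    · rw [Nat.ble_eq, mask_getD]
      have e1 : (2 * (t.getD a 0 : ℕ) - (dot (K.getD a []) t : ℕ) : ℤ) = (q.getD a 0 : ℕ) := by omega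
      have e2 : (2 * (t.getD b 0 : ℕ) - (dot (K.getD b []) t : ℕ) : ℤ) = (q.getD b 0 : ℕ) := by omega
      rw [e1, e2, if_pos ha, LA, if_neg hab.symm, mul_one, sub_neg_eq_add] at hle
      have : ((if e b ∈ Sg then 1 else 0 : ℤ)) = ((if e b ∈ Sg then 1 else 0 : ℕ) : ℤ) := by
        split_ifs <;> simp
      rw [this] at hle
      exact_mod_cast hle
  simpa [h2, h3] using h1

theorem setup_of_type {n : ℕ} {α : ℕ → V} {M : ℕ → ℕ → ℝ} {K : List (List ℕ)}
    (h : R.IsTypeOf n α M)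
    (hM : ∀ i j : Fin n, M (i + 1) (j + 1) = ((LA n K i j : ℤ) : ℝ)) :
    Setup R (fun i : Fin n => α (i + 1)) (LA n K) := by
  obtain ⟨h1, h2, h3⟩ := h
  refine ⟨?_, ?_, ?_⟩
  · intro i j hij
    have := h1 (x₁ := (i : ℕ) + 1) (by simp) (x₂ := (j : ℕ) + 1) (by simp) hij
    exact Fin.ext (by omega)
  · rw [h2]
    ext v
    simp only [Finset.mem_image, Finset.mem_Icc, Finset.mem_univ, true_and]
    constructor
    · rintro ⟨a, ⟨ha, hb⟩, rfl⟩
      exact ⟨⟨a - 1, by omega⟩, by simp [Nat.sub_add_cancel ha]⟩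
    · rintro ⟨a, rfl⟩
      exact ⟨a + 1, by simp, rfl⟩
  · intro i j
    rw [← hM]
    exact h3 _ (by simp) _ (by simp)


/-- Off-diagonal Cartan data of type G2. -/
def KG2 : List (List ℕ) := [[0, 3], [1, 0]]

/-- Positive roots of type G2. -/
def PG2 : List (List ℕ) := [[1, 0], [0, 1], [1, 1], [3, 1], [2, 1], [3, 2]]

theorem okKG2 : OkK 2 KG2 := by unfold OkK; decide +kernel

theorem okPG2 : OkP 2 KG2 PG2 where
  len := by decide +kernel
  unit := by decide +kernel
  up := by decide +kernel
  down := by decide +kernel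
  nodup := by decide +kernel

theorem okTG2 : OkT 2 KG2 PG2 [3, 2] [0, 1] where
  mem := by decide +kernel
  top := by decide +kernel
  dom := by decide +kernel

theorem chkG2 : allMask 2 (fun s => !(nrC 2 KG2 [3, 2] [0, 1] s) ||
    !(Nat.beq (cnt PG2 s 1) (cnt PG2 s 2 + 1)) ||
    (s == [1, 0] || s == [1, 1])) = true := by
  decide +kernel

/-- Off-diagonal Cartan data of type F4. -/
def KF4 : List (List ℕ) := [[0, 1, 0, 0], [1, 0, 1, 0], [0, 2, 0, 1], [0, 0, 1, 0]]

/-- Positive roots of type F4. -/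
def PF4 : List (List ℕ) := [
    [1, 0, 0, 0], [0, 1, 0, 0], [0, 0, 1, 0], [0, 0, 0, 1], [1, 1, 0, 0], [0, 1, 2, 0],
    [0, 1, 1, 0], [0, 0, 1, 1], [1, 1, 2, 0], [0, 1, 2, 2], [1, 1, 1, 0], [0, 1, 1, 1],
    [1, 2, 2, 0], [1, 1, 2, 2], [1, 1, 1, 1], [0, 1, 2, 1], [1, 2, 2, 2], [1, 1, 2, 1],
    [1, 2, 4, 2], [1, 2, 2, 1], [1, 3, 4, 2], [1, 2, 3, 1], [2, 3, 4, 2], [1, 2, 3, 2]]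

theorem okKF4 : OkK 4 KF4 := by unfold OkK; decide +kernel

theorem okPF4 : OkP 4 KF4 PF4 where
  len := by decide +kernel
  unit := by decide +kernel
  up := by decide +kernel
  down := by decide +kernel
  nodup := by decide +kernel

theorem okTF4 : OkT 4 KF4 PF4 [2, 3, 4, 2] [1, 0, 0, 0] where
  mem := by decide +kernel
  top := by decide +kernel
  dom := by decide +kernel

theorem chkF4 : allMask 4 (fun s => !(nrC 4 KF4 [2, 3, 4, 2] [1, 0, 0, 0] s) ||
    !(Nat.beq (cnt PF4 s 1) (cnt PF4 s 2 + 1)) ||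
    false) = true := by
  decide +kernel

/-- Off-diagonal Cartan data of type E6. -/
def KE6 : List (List ℕ) := [
    [0, 0, 1, 0, 0, 0], [0, 0, 0, 1, 0, 0], [1, 0, 0, 1, 0, 0], [0, 1, 1, 0, 1, 0],
    [0, 0, 0, 1, 0, 1], [0, 0, 0, 0, 1, 0]]

/-- Positive roots of type E6. -/
def PE6 : List (List ℕ) := [
    [1, 0, 0, 0, 0, 0], [0, 1, 0, 0, 0, 0], [0, 0, 1, 0, 0, 0], [0, 0, 0, 1, 0, 0],
    [0, 0, 0, 0, 1, 0], [0, 0, 0, 0, 0, 1], [1, 0, 1, 0, 0, 0], [0, 1, 0, 1, 0, 0],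
    [0, 0, 1, 1, 0, 0], [0, 0, 0, 1, 1, 0], [0, 0, 0, 0, 1, 1], [1, 0, 1, 1, 0, 0],
    [0, 1, 1, 1, 0, 0], [0, 1, 0, 1, 1, 0], [0, 0, 1, 1, 1, 0], [0, 0, 0, 1, 1, 1],
    [1, 1, 1, 1, 0, 0], [1, 0, 1, 1, 1, 0], [0, 1, 1, 1, 1, 0], [0, 1, 0, 1, 1, 1],
    [0, 0, 1, 1, 1, 1], [1, 1, 1, 1, 1, 0], [1, 0, 1, 1, 1, 1], [0, 1, 1, 2, 1, 0],
    [0, 1, 1, 1, 1, 1], [1, 1, 1, 2, 1, 0], [1, 1, 1, 1, 1, 1], [0, 1, 1, 2, 1, 1],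
    [1, 1, 2, 2, 1, 0], [1, 1, 1, 2, 1, 1], [0, 1, 1, 2, 2, 1], [1, 1, 2, 2, 1, 1],
    [1, 1, 1, 2, 2, 1], [1, 1, 2, 2, 2, 1], [1, 1, 2, 3, 2, 1], [1, 2, 2, 3, 2, 1]]

theorem okKE6 : OkK 6 KE6 := by unfold OkK; decide +kernel

theorem okPE6 : OkP 6 KE6 PE6 where
  len := by decide +kernel
  unit := by decide +kernel
  up := by decide +kernel
  down := by decide +kernel
  nodup := by decide +kernel

theorem okTE6 : OkT 6 KE6 PE6 [1, 2, 2, 3, 2, 1] [0, 1, 0, 0, 0, 0] where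
  mem := by decide +kernel
  top := by decide +kernel
  dom := by decide +kernel

theorem chkE6 : allMask 6 (fun s => !(nrC 6 KE6 [1, 2, 2, 3, 2, 1] [0, 1, 0, 0, 0, 0] s) ||
    !(Nat.beq (cnt PE6 s 1) (cnt PE6 s 2 + 1)) ||
    false) = true := by
  decide +kernel

/-- Off-diagonal Cartan data of type E7. -/
def KE7 : List (List ℕ) := [
    [0, 0, 1, 0, 0, 0, 0], [0, 0, 0, 1, 0, 0, 0], [1, 0, 0, 1, 0, 0, 0], [0, 1, 1, 0, 1, 0, 0],
    [0, 0, 0, 1, 0, 1, 0], [0, 0, 0, 0, 1, 0, 1], [0, 0, 0, 0, 0, 1, 0]]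

/-- Positive roots of type E7. -/
def PE7 : List (List ℕ) := [
    [1, 0, 0, 0, 0, 0, 0], [0, 1, 0, 0, 0, 0, 0], [0, 0, 1, 0, 0, 0, 0], [0, 0, 0, 1, 0, 0, 0],
    [0, 0, 0, 0, 1, 0, 0], [0, 0, 0, 0, 0, 1, 0], [0, 0, 0, 0, 0, 0, 1], [1, 0, 1, 0, 0, 0, 0],
    [0, 1, 0, 1, 0, 0, 0], [0, 0, 1, 1, 0, 0, 0], [0, 0, 0, 1, 1, 0, 0], [0, 0, 0, 0, 1, 1, 0],
    [0, 0, 0, 0, 0, 1, 1], [1, 0, 1, 1, 0, 0, 0], [0, 1, 1, 1, 0, 0, 0], [0, 1, 0, 1, 1, 0, 0],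
    [0, 0, 1, 1, 1, 0, 0], [0, 0, 0, 1, 1, 1, 0], [0, 0, 0, 0, 1, 1, 1], [1, 1, 1, 1, 0, 0, 0],
    [1, 0, 1, 1, 1, 0, 0], [0, 1, 1, 1, 1, 0, 0], [0, 1, 0, 1, 1, 1, 0], [0, 0, 1, 1, 1, 1, 0],
    [0, 0, 0, 1, 1, 1, 1], [1, 1, 1, 1, 1, 0, 0], [1, 0, 1, 1, 1, 1, 0], [0, 1, 1, 2, 1, 0, 0],
    [0, 1, 1, 1, 1, 1, 0], [0, 1, 0, 1, 1, 1, 1], [0, 0, 1, 1, 1, 1, 1], [1, 1, 1, 2, 1, 0, 0],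
    [1, 1, 1, 1, 1, 1, 0], [1, 0, 1, 1, 1, 1, 1], [0, 1, 1, 2, 1, 1, 0], [0, 1, 1, 1, 1, 1, 1],
    [1, 1, 2, 2, 1, 0, 0], [1, 1, 1, 2, 1, 1, 0], [1, 1, 1, 1, 1, 1, 1], [0, 1, 1, 2, 2, 1, 0],
    [0, 1, 1, 2, 1, 1, 1], [1, 1, 2, 2, 1, 1, 0], [1, 1, 1, 2, 2, 1, 0], [1, 1, 1, 2, 1, 1, 1],
    [0, 1, 1, 2, 2, 1, 1], [1, 1, 2, 2, 2, 1, 0], [1, 1, 2, 2, 1, 1, 1], [1, 1, 1, 2, 2, 1, 1],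
    [0, 1, 1, 2, 2, 2, 1], [1, 1, 2, 3, 2, 1, 0], [1, 1, 2, 2, 2, 1, 1], [1, 1, 1, 2, 2, 2, 1],
    [1, 2, 2, 3, 2, 1, 0], [1, 1, 2, 3, 2, 1, 1], [1, 1, 2, 2, 2, 2, 1], [1, 2, 2, 3, 2, 1, 1],
    [1, 1, 2, 3, 2, 2, 1], [1, 2, 2, 3, 2, 2, 1], [1, 1, 2, 3, 3, 2, 1], [1, 2, 2, 3, 3, 2, 1],
    [1, 2, 2, 4, 3, 2, 1], [1, 2, 3, 4, 3, 2, 1], [2, 2, 3, 4, 3, 2, 1]]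

theorem okKE7 : OkK 7 KE7 := by unfold OkK; decide +kernel

theorem okPE7 : OkP 7 KE7 PE7 where
  len := by decide +kernel
  unit := by decide +kernel
  up := by decide +kernel
  down := by decide +kernel
  nodup := by decide +kernel

theorem okTE7 : OkT 7 KE7 PE7 [2, 2, 3, 4, 3, 2, 1] [1, 0, 0, 0, 0, 0, 0] where
  mem := by decide +kernel
  top := by decide +kernel
  dom := by decide +kernel

theorem chkE7 : allMask 7 (fun s => !(nrC 7 KE7 [2, 2, 3, 4, 3, 2, 1] [1, 0, 0, 0, 0, 0, 0] s) ||
    !(Nat.beq (cnt PE7 s 1) (cnt PE7 s 2 + 1)) ||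
    false) = true := by
  decide +kernel

/-- Off-diagonal Cartan data of type E8. -/
def KE8 : List (List ℕ) := [
    [0, 0, 1, 0, 0, 0, 0, 0], [0, 0, 0, 1, 0, 0, 0, 0], [1, 0, 0, 1, 0, 0, 0, 0],
    [0, 1, 1, 0, 1, 0, 0, 0], [0, 0, 0, 1, 0, 1, 0, 0], [0, 0, 0, 0, 1, 0, 1, 0],
    [0, 0, 0, 0, 0, 1, 0, 1], [0, 0, 0, 0, 0, 0, 1, 0]]

/-- Positive roots of type E8. -/
def PE8 : List (List ℕ) := [
    [1, 0, 0, 0, 0, 0, 0, 0], [0, 1, 0, 0, 0, 0, 0, 0], [0, 0, 1, 0, 0, 0, 0, 0],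
    [0, 0, 0, 1, 0, 0, 0, 0], [0, 0, 0, 0, 1, 0, 0, 0], [0, 0, 0, 0, 0, 1, 0, 0],
    [0, 0, 0, 0, 0, 0, 1, 0], [0, 0, 0, 0, 0, 0, 0, 1], [1, 0, 1, 0, 0, 0, 0, 0],
    [0, 1, 0, 1, 0, 0, 0, 0], [0, 0, 1, 1, 0, 0, 0, 0], [0, 0, 0, 1, 1, 0, 0, 0],
    [0, 0, 0, 0, 1, 1, 0, 0], [0, 0, 0, 0, 0, 1, 1, 0], [0, 0, 0, 0, 0, 0, 1, 1],
    [1, 0, 1, 1, 0, 0, 0, 0], [0, 1, 1, 1, 0, 0, 0, 0], [0, 1, 0, 1, 1, 0, 0, 0],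
    [0, 0, 1, 1, 1, 0, 0, 0], [0, 0, 0, 1, 1, 1, 0, 0], [0, 0, 0, 0, 1, 1, 1, 0],
    [0, 0, 0, 0, 0, 1, 1, 1], [1, 1, 1, 1, 0, 0, 0, 0], [1, 0, 1, 1, 1, 0, 0, 0],
    [0, 1, 1, 1, 1, 0, 0, 0], [0, 1, 0, 1, 1, 1, 0, 0], [0, 0, 1, 1, 1, 1, 0, 0],
    [0, 0, 0, 1, 1, 1, 1, 0], [0, 0, 0, 0, 1, 1, 1, 1], [1, 1, 1, 1, 1, 0, 0, 0],
    [1, 0, 1, 1, 1, 1, 0, 0], [0, 1, 1, 2, 1, 0, 0, 0], [0, 1, 1, 1, 1, 1, 0, 0],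
    [0, 1, 0, 1, 1, 1, 1, 0], [0, 0, 1, 1, 1, 1, 1, 0], [0, 0, 0, 1, 1, 1, 1, 1],
    [1, 1, 1, 2, 1, 0, 0, 0], [1, 1, 1, 1, 1, 1, 0, 0], [1, 0, 1, 1, 1, 1, 1, 0],
    [0, 1, 1, 2, 1, 1, 0, 0], [0, 1, 1, 1, 1, 1, 1, 0], [0, 1, 0, 1, 1, 1, 1, 1],
    [0, 0, 1, 1, 1, 1, 1, 1], [1, 1, 2, 2, 1, 0, 0, 0], [1, 1, 1, 2, 1, 1, 0, 0],
    [1, 1, 1, 1, 1, 1, 1, 0], [1, 0, 1, 1, 1, 1, 1, 1], [0, 1, 1, 2, 2, 1, 0, 0],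
    [0, 1, 1, 2, 1, 1, 1, 0], [0, 1, 1, 1, 1, 1, 1, 1], [1, 1, 2, 2, 1, 1, 0, 0],
    [1, 1, 1, 2, 2, 1, 0, 0], [1, 1, 1, 2, 1, 1, 1, 0], [1, 1, 1, 1, 1, 1, 1, 1],
    [0, 1, 1, 2, 2, 1, 1, 0], [0, 1, 1, 2, 1, 1, 1, 1], [1, 1, 2, 2, 2, 1, 0, 0],
    [1, 1, 2, 2, 1, 1, 1, 0], [1, 1, 1, 2, 2, 1, 1, 0], [1, 1, 1, 2, 1, 1, 1, 1],
    [0, 1, 1, 2, 2, 2, 1, 0], [0, 1, 1, 2, 2, 1, 1, 1], [1, 1, 2, 3, 2, 1, 0, 0],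
    [1, 1, 2, 2, 2, 1, 1, 0], [1, 1, 2, 2, 1, 1, 1, 1], [1, 1, 1, 2, 2, 2, 1, 0],
    [1, 1, 1, 2, 2, 1, 1, 1], [0, 1, 1, 2, 2, 2, 1, 1], [1, 2, 2, 3, 2, 1, 0, 0],
    [1, 1, 2, 3, 2, 1, 1, 0], [1, 1, 2, 2, 2, 2, 1, 0], [1, 1, 2, 2, 2, 1, 1, 1],
    [1, 1, 1, 2, 2, 2, 1, 1], [0, 1, 1, 2, 2, 2, 2, 1], [1, 2, 2, 3, 2, 1, 1, 0],
    [1, 1, 2, 3, 2, 2, 1, 0], [1, 1, 2, 3, 2, 1, 1, 1], [1, 1, 2, 2, 2, 2, 1, 1],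
    [1, 1, 1, 2, 2, 2, 2, 1], [1, 2, 2, 3, 2, 2, 1, 0], [1, 2, 2, 3, 2, 1, 1, 1],
    [1, 1, 2, 3, 3, 2, 1, 0], [1, 1, 2, 3, 2, 2, 1, 1], [1, 1, 2, 2, 2, 2, 2, 1],
    [1, 2, 2, 3, 3, 2, 1, 0], [1, 2, 2, 3, 2, 2, 1, 1], [1, 1, 2, 3, 3, 2, 1, 1],
    [1, 1, 2, 3, 2, 2, 2, 1], [1, 2, 2, 4, 3, 2, 1, 0], [1, 2, 2, 3, 3, 2, 1, 1],
    [1, 2, 2, 3, 2, 2, 2, 1], [1, 1, 2, 3, 3, 2, 2, 1], [1, 2, 3, 4, 3, 2, 1, 0],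
    [1, 2, 2, 4, 3, 2, 1, 1], [1, 2, 2, 3, 3, 2, 2, 1], [1, 1, 2, 3, 3, 3, 2, 1],
    [2, 2, 3, 4, 3, 2, 1, 0], [1, 2, 3, 4, 3, 2, 1, 1], [1, 2, 2, 4, 3, 2, 2, 1],
    [1, 2, 2, 3, 3, 3, 2, 1], [2, 2, 3, 4, 3, 2, 1, 1], [1, 2, 3, 4, 3, 2, 2, 1],
    [1, 2, 2, 4, 3, 3, 2, 1], [2, 2, 3, 4, 3, 2, 2, 1], [1, 2, 3, 4, 3, 3, 2, 1],
    [1, 2, 2, 4, 4, 3, 2, 1], [2, 2, 3, 4, 3, 3, 2, 1], [1, 2, 3, 4, 4, 3, 2, 1],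
    [2, 2, 3, 4, 4, 3, 2, 1], [1, 2, 3, 5, 4, 3, 2, 1], [2, 2, 3, 5, 4, 3, 2, 1],
    [1, 3, 3, 5, 4, 3, 2, 1], [2, 3, 3, 5, 4, 3, 2, 1], [2, 2, 4, 5, 4, 3, 2, 1],
    [2, 3, 4, 5, 4, 3, 2, 1], [2, 3, 4, 6, 4, 3, 2, 1], [2, 3, 4, 6, 5, 3, 2, 1],
    [2, 3, 4, 6, 5, 4, 2, 1], [2, 3, 4, 6, 5, 4, 3, 1], [2, 3, 4, 6, 5, 4, 3, 2]]

theorem okKE8 : OkK 8 KE8 := by unfold OkK; decide +kernel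

theorem okPE8 : OkP 8 KE8 PE8 where
  len := by decide +kernel
  unit := by decide +kernel
  up := by decide +kernel
  down := by decide +kernel
  nodup := by decide +kernel

theorem okTE8 : OkT 8 KE8 PE8 [2, 3, 4, 6, 5, 4, 3, 2] [0, 0, 0, 0, 0, 0, 0, 1] where
  mem := by decide +kernel
  top := by decide +kernel
  dom := by decide +kernel

theorem chkE8 : allMask 8 (fun s => !(nrC 8 KE8 [2, 3, 4, 6, 5, 4, 3, 2] [0, 0, 0, 0, 0, 0, 0, 1] s) ||
    !(Nat.beq (cnt PE8 s 1) (cnt PE8 s 2 + 1)) ||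
    false) = true := by
  decide +kernel

theorem matG2_eq (i j : Fin 2) : matG2 (i + 1) (j + 1) = ((LA 2 KG2 i j : ℤ) : ℝ) := by
  fin_cases i <;> fin_cases j <;> simp [matG2, LA, KG2]

theorem matF4_eq (i j : Fin 4) : matF4 (i + 1) (j + 1) = ((LA 4 KF4 i j : ℤ) : ℝ) := by
  have h : ∀ i j : Fin 4, (if (i : ℕ) + 1 = j + 1 then 2 else
      if (i : ℕ) + 1 = 2 ∧ (j : ℕ) + 1 = 3 then -2 else
      if (i : ℕ) + 1 + 1 = j + 1 ∨ (j : ℕ) + 1 + 1 = i + 1 then -1 else 0 : ℤ) = LA 4 KF4 i j := by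
    decide +kernel
  rw [← h i j]
  unfold matF4
  push_cast
  rfl

theorem matE_eq (n : ℕ) (K : List (List ℕ))
    (h : ∀ i j : Fin n, (if (i : ℕ) + 1 = j + 1 then 2 else
      if (min ((i : ℕ) + 1) (j + 1), max ((i : ℕ) + 1) (j + 1)) ∈
        ([(1,3),(3,4),(4,5),(5,6),(2,4),(6,7),(7,8)].filter (fun p => p.2 ≤ n))
      then -1 else 0 : ℤ) = LA n K i j) (i j : Fin n) :
    matE n (i + 1) (j + 1) = ((LA n K i j : ℤ) : ℝ) := by
  rw [← h i j]
  unfold matE eAdj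
  split_ifs <;> simp_all

theorem matE6_eq : ∀ i j : Fin 6, matE 6 (i + 1) (j + 1) = ((LA 6 KE6 i j : ℤ) : ℝ) :=
  matE_eq 6 KE6 (by decide +kernel)

theorem matE7_eq : ∀ i j : Fin 7, matE 7 (i + 1) (j + 1) = ((LA 7 KE7 i j : ℤ) : ℝ) :=
  matE_eq 7 KE7 (by decide +kernel)

theorem matE8_eq : ∀ i j : Fin 8, matE 8 (i + 1) (j + 1) = ((LA 8 KE8 i j : ℤ) : ℝ) :=
  matE_eq 8 KE8 (by decide +kernel)

section G2

variable {L : Type*} [LieRing L] [LieAlgebra ℂ L] [FiniteDimensional ℂ L]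

theorem monge_G2 (G : GradedLieData V L) {e : Fin 2 → V} (S : Setup G.base e (LA 2 KG2))
    {Sg : Finset V} (hSg : Sg ⊆ G.base.Δ0) (h0 : e 0 ∈ Sg)
    (hm : mask e Sg = [1, 0] ∨ mask e Sg = [1, 1]) : G.Monge Sg := by
  have hR := posRoots_of_ok S okKG2 okPG2
  have h1 := finrank_g G S hR hSg 1 (by norm_num)
  have h2 := finrank_g G S hR hSg 2 (by norm_num)
  have c1 := card_PF okPG2 e Sg 1
  have c2 := card_PF okPG2 e Sg 2
  push_cast at c1 c2
  rw [c1] at h1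
  rw [c2] at h2
  have n1 : cnt PG2 (mask e Sg) 1 = 2 := by
    rcases hm with h | h <;> rw [h] <;> decide +kernel
  have n2 : cnt PG2 (mask e Sg) 2 = 1 := by
    rcases hm with h | h <;> rw [h] <;> decide +kernel
  rw [n1] at h1
  rw [n2] at h2
  have hs : toV e (Pi.single 0 1) ∈ G.base.Δ := by rw [toV_single]; exact S.mem 0
  have hn := S.neg_mem hs
  have hdim := G.rs_dim _ hn
  refine ⟨G.rs (toV e (-(Pi.single 0 1))), ?_, ?_, ?_, ?_, ?_⟩
  · unfold GradedLieData.g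
    rw [if_neg (by norm_num)]
    refine le_biSup G.rs ?_
    rw [Finset.mem_coe, Finset.mem_filter]
    refine ⟨hn, ?_⟩
    rw [S.ht_toV hSg hn, hv_neg, hv_single, if_pos h0]
  · intro hb
    rw [hb, finrank_bot] at hdim
    omega
  · intro a ha b hb
    obtain ⟨v, -, hv⟩ := finrank_eq_one_iff'.1 hdim
    obtain ⟨x, hx⟩ := hv ⟨a, ha⟩
    obtain ⟨y, hy⟩ := hv ⟨b, hb⟩
    have hx' : a = x • (v : L) := by rw [← Submodule.coe_smul, hx]
    have hy' : b = y • (v : L) := by rw [← Submodule.coe_smul, hy]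
    rw [hx', hy']; simp
  · rw [hdim, h1]
  · rw [hdim, h2]

theorem nonRigid_G2 {e : Fin 2 → V} (S : Setup R e (LA 2 KG2))
    {Sg : Finset V} (hSg : Sg ⊆ R.Δ0) (h0 : e 0 ∈ Sg)
    (hm : mask e Sg = [1, 0] ∨ mask e Sg = [1, 1]) {θ : V} (hθ : R.IsHighest θ) :
    R.NonRigid Sg θ := by
  have hR := posRoots_of_ok S okKG2 okPG2
  have hmem : ∀ c ∈ PG2, toV e (fl 2 c) ∈ R.Δ := fun c hc => hR.root _ (by
    simp only [PF, List.mem_toFinset, List.mem_map]; exact ⟨c, hc, rfl⟩)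
  have hθ' := highest_eq S okKG2 okPG2 okTG2 hθ
  have hrr : ∀ c : Fin 2 → ℤ, RootSystemBase.refl (e 1) (RootSystemBase.refl (e 0) (toV e c)) =
      toV e (sr (LA 2 KG2) 1 (sr (LA 2 KG2) 0 c)) := fun c => by rw [refl_toV S, refl_toV S]
  have hD : R.Dsig (e 0) (e 1) = {toV e (fl 2 [1, 0]), toV e (fl 2 [3, 1])} := by
    ext β
    unfold Dsig
    rw [Finset.mem_filter, Finset.mem_insert, Finset.mem_singleton]
    constructor
    · rintro ⟨hβ, hp, hn⟩
      obtain ⟨c, rfl⟩ : ∃ c, toV e c = β := ⟨_, S.toV_cv hβ⟩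
      rw [S.isPos] at hp
      have hc := hR.all c hβ hp.2
      simp only [PF, List.mem_toFinset, List.mem_map] at hc
      obtain ⟨d, hd, rfl⟩ := hc
      rw [hrr, S.isNeg] at hn
      have key : ∀ d ∈ PG2, sr (LA 2 KG2) 1 (sr (LA 2 KG2) 0 (fl 2 d)) ≤ 0 →
          d = [1, 0] ∨ d = [3, 1] := by
        have k0 : ∀ d ∈ PG2, (∀ i, sr (LA 2 KG2) 1 (sr (LA 2 KG2) 0 (fl 2 d)) i ≤ 0) →
          d = [1, 0] ∨ d = [3, 1] := by decide +kernel
        exact fun d hd h => k0 d hd fun i => h i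
      rcases key d hd hn.2 with rfl | rfl
      · exact Or.inl rfl
      · exact Or.inr rfl
    · have key : ∀ d ∈ PG2, (d = [1, 0] ∨ d = [3, 1]) →
        toV e (fl 2 d) ∈ R.Δ ∧ R.IsPos (toV e (fl 2 d)) ∧
          R.IsNeg (RootSystemBase.refl (e 1) (RootSystemBase.refl (e 0) (toV e (fl 2 d)))) := by
        intro d hd hdd
        have h1 := hmem d hd
        refine ⟨h1, ?_, ?_⟩
        · rw [S.isPos]; exact ⟨h1, fl_nonneg d⟩
        · rw [hrr, S.isNeg]
          refine ⟨S.sr_mem (S.sr_mem h1 0) 1, ?_⟩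
          have k1 : ∀ i, sr (LA 2 KG2) 1 (sr (LA 2 KG2) 0 (fl 2 d)) i ≤ 0 := by
            rcases hdd with rfl | rfl <;> decide +kernel
          exact fun i => k1 i
      rintro (rfl | rfl)
      · exact key _ (by decide +kernel) (Or.inl rfl)
      · exact key _ (by decide +kernel) (Or.inr rfl)
  have hne : toV e (fl 2 [1, 0]) ≠ toV e (fl 2 [3, 1]) := by
    intro h
    have := S.toV_inj h
    revert this
    decide +kernel
  have hht : ∀ c ∈ PG2, R.ht Sg (toV e (fl 2 c)) = (dot (mask e Sg) c : ℕ) := fun c hc => by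
    rw [S.ht_toV hSg (hmem c hc), hv_fl e Sg (okPG2.len c hc)]
  refine ⟨e 0, S.mem0 0, e 1, S.mem0 1, ?_, ?_, ?_, ?_⟩
  · intro h; have := S.inj h; simp at this
  · rw [hD, Finset.card_pair hne]
  · intro β hβ
    rw [hD, Finset.mem_insert, Finset.mem_singleton] at hβ
    rcases hβ with rfl | rfl
    · rw [hht _ (by decide +kernel)]
      rcases hm with h | h <;> rw [h] <;> decide +kernel
    · rw [hht _ (by decide +kernel)]
      rcases hm with h | h <;> rw [h] <;> decide +kernel
  · have h1 : RootSystemBase.refl (e 0) (e 1) = toV e (fl 2 [3, 1]) := by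
      rw [← toV_single e 1, refl_toV S]
      congr 1
      decide +kernel
    rw [h1, hθ', hht _ (by decide +kernel), hht _ (by decide +kernel), cInt_toV S, cInt_toV S]
    have p0 : pr (LA 2 KG2) (fl 2 [3, 2]) 0 = 0 := by decide +kernel
    have p1 : pr (LA 2 KG2) (fl 2 [3, 2]) 1 = 1 := by decide +kernel
    rw [p0, p1]
    rcases hm with h | h <;> rw [h] <;> norm_num [dot]

end G2

end Exc

/-- Among the exceptional complex simple Lie algebras
`G₂, F₄, E₆, E₇, E₈` (simple roots labelled as in Humphreys, with `α₁` the short root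
of `G₂`), the only non-rigid gradings of Monge type are those of `G₂` with
`Σ = {α₁}` and with `Σ = {α₁, α₂}`. -/
theorem statement16 {V : Type*} [NormedAddCommGroup V] [InnerProductSpace ℝ V]
    {L : Type*} [LieRing L] [LieAlgebra ℂ L] [FiniteDimensional ℂ L]
    (G : GradedLieData V L)
    (hexc : (∃ α : ℕ → V, G.base.IsTypeOf 2 α RootSystemBase.matG2) ∨
            (∃ α : ℕ → V, G.base.IsTypeOf 4 α RootSystemBase.matF4) ∨
            (∃ α : ℕ → V, G.base.IsTypeOf 6 α (RootSystemBase.matE 6)) ∨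
            (∃ α : ℕ → V, G.base.IsTypeOf 7 α (RootSystemBase.matE 7)) ∨
            (∃ α : ℕ → V, G.base.IsTypeOf 8 α (RootSystemBase.matE 8)))
    (Sg : Finset V) (hSg : Sg ⊆ G.base.Δ0) (hne : Sg.Nonempty)
    (θ : V) (hθ : G.base.IsHighest θ) :
    (G.Monge Sg ∧ G.base.NonRigid Sg θ) ↔
      ∃ α : ℕ → V, G.base.IsTypeOf 2 α RootSystemBase.matG2 ∧
        (Sg = {α 1} ∨ Sg = {α 1, α 2}) := by
  constructor
  · rintro ⟨hM, hN⟩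
    rcases hexc with ⟨α, h⟩ | ⟨α, h⟩ | ⟨α, h⟩ | ⟨α, h⟩ | ⟨α, h⟩
    · refine ⟨α, h, ?_⟩
      have S := Exc.setup_of_type h Exc.matG2_eq
      have hg := Exc.main_check G S Exc.okKG2 Exc.okPG2 Exc.okTG2 hSg hθ
        (fun s => s == [1, 0] || s == [1, 1]) Exc.chkG2 hM hN
      have hb : ∀ v ∈ Sg, v = α 1 ∨ v = α 2 := by
        intro v hv
        have := hSg hv
        rw [S.base] at this
        simp only [Finset.mem_image, Finset.mem_univ, true_and] at this
        obtain ⟨i, rfl⟩ := this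
        fin_cases i
        · exact Or.inl rfl
        · exact Or.inr rfl
      by_cases h1 : α 1 ∈ Sg
      · by_cases h2 : α 2 ∈ Sg
        · right
          ext v
          simp only [Finset.mem_insert, Finset.mem_singleton]
          exact ⟨hb v, by rintro (rfl | rfl) <;> assumption⟩
        · left
          ext v
          simp only [Finset.mem_singleton]
          refine ⟨fun hv => (hb v hv).resolve_right ?_, by rintro rfl; assumption⟩
          rintro rfl; exact h2 hv
      · exfalso
        simp [Exc.mask, h1] at hg
    · exact absurd (Exc.main_check G (Exc.setup_of_type h Exc.matF4_eq) Exc.okKF4 Exc.okPF4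
        Exc.okTF4 hSg hθ (fun _ => false) Exc.chkF4 hM hN) (by simp)
    · exact absurd (Exc.main_check G (Exc.setup_of_type h Exc.matE6_eq) Exc.okKE6 Exc.okPE6
        Exc.okTE6 hSg hθ (fun _ => false) Exc.chkE6 hM hN) (by simp)
    · exact absurd (Exc.main_check G (Exc.setup_of_type h Exc.matE7_eq) Exc.okKE7 Exc.okPE7
        Exc.okTE7 hSg hθ (fun _ => false) Exc.chkE7 hM hN) (by simp)
    · exact absurd (Exc.main_check G (Exc.setup_of_type h Exc.matE8_eq) Exc.okKE8 Exc.okPE8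
        Exc.okTE8 hSg hθ (fun _ => false) Exc.chkE8 hM hN) (by simp)
  · rintro ⟨α, h, hS⟩
    have S := Exc.setup_of_type h Exc.matG2_eq
    have h12 : α 2 ≠ α 1 := by
      intro h12
      have := h.1 (x₁ := 2) (by simp) (x₂ := 1) (by simp) h12
      omega
    have h0 : α 1 ∈ Sg := by rcases hS with rfl | rfl <;> simp
    have hm : Exc.mask (fun i : Fin 2 => α (i + 1)) Sg = [1, 0] ∨
        Exc.mask (fun i : Fin 2 => α (i + 1)) Sg = [1, 1] := by
      rcases hS with rfl | rfl
      · left; simp [Exc.mask, h12]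
      · right; simp [Exc.mask]
    exact ⟨Exc.monge_G2 G S hSg h0 hm, Exc.nonRigid_G2 S hSg h0 hm hθ⟩
end

section
/- Let m ≥ 2 and let κ = (κ_{ij}) be a nondegenerate symmetric real m×m matrix of signature (r, s), r + s = m. On ℝ^{2m+2} with coordinates (x, y¹, …, y^m, z, p¹, …, p^m), let 𝒟 be the rank-(m+1) distribution spanned at every point by the vector fields ∂_{p¹}, …, ∂_{p^m} and D_x = ∂_x + Σᵢ pⁱ ∂_{yⁱ} + (1/2) Σ_{i,j} κ_{ij} pⁱ pʲ ∂_z (the canonical distribution of the Monge equation ż = (1/2) κ_{ij} ẏⁱ ẏʲ). Then the Lie algebra sym(𝒟) of all smooth vector fields X on ℝ^{2m+2} such that [X, V] is a section of 𝒟 for every section V of 𝒟 is finite dimensional and isomorphic, as a real Lie algebra, to so(r+2, s+2). -/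
open scoped BigOperators

/-- Coordinates `(x, y¹, …, y^m, z, p¹, …, p^m)` on `ℝ^{2m+2}`. -/
inductive MCo (m : ℕ) : Type
  | x : MCo m
  | y : Fin m → MCo m
  | z : MCo m
  | p : Fin m → MCo m
  deriving DecidableEq, Fintype

/-- Points of `ℝ^{2m+2}`. -/
abbrev MPt (m : ℕ) := MCo m → ℝ

/-- The constant coordinate vector field `∂ᵢ`. -/
def munit (m : ℕ) (i : MCo m) : MPt m := fun j => if j = i then 1 else 0

/-- The total derivative vector field
`D_x = ∂_x + Σᵢ pⁱ ∂_{yⁱ} + (1/2) Σ_{i,j} κ_{ij} pⁱ pʲ ∂_z` of the Monge equation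
`ż = (1/2) κ_{ij} ẏⁱ ẏʲ`. -/
noncomputable def mDx (m : ℕ) (κ : Fin m → Fin m → ℝ) : MPt m → MPt m := fun q =>
  munit m MCo.x + (∑ i : Fin m, q (MCo.p i) • munit m (MCo.y i)) +
    ((1 / 2) * ∑ i : Fin m, ∑ j : Fin m, κ i j * q (MCo.p i) * q (MCo.p j)) • munit m MCo.z

/-- The canonical rank-`(m+1)` distribution of the Monge equation
`ż = (1/2) κ_{ij} ẏⁱ ẏʲ`, spanned by `∂_{p¹}, …, ∂_{p^m}` and `D_x`. -/
noncomputable def mDist (m : ℕ) (κ : Fin m → Fin m → ℝ) (q : MPt m) :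
    Submodule ℝ (MPt m) :=
  Submodule.span ℝ (insert (mDx m κ q) (Set.range fun i : Fin m => munit m (MCo.p i)))

/-- The Lie bracket of vector fields on `ℝ^{2m+2}`. -/
noncomputable def mBr (m : ℕ) (X W : MPt m → MPt m) : MPt m → MPt m := fun q =>
  fderiv ℝ W q (X q) - fderiv ℝ X q (W q)

/-- The Lie algebra of infinitesimal symmetries of the distribution `mDist`:
smooth vector fields `X` with `[X, W]` a section of the distribution for every
smooth section `W` of it. -/
noncomputable def mSym (m : ℕ) (κ : Fin m → Fin m → ℝ) : Set (MPt m → MPt m) :=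
  {X | ContDiff ℝ (⊤ : ℕ∞) X ∧ ∀ W : MPt m → MPt m, ContDiff ℝ (⊤ : ℕ∞) W →
    (∀ q, W q ∈ mDist m κ q) → ∀ q, mBr m X W q ∈ mDist m κ q}

section AbstractConformal

lemma mtwo_le : minSmoothness ℝ 2 ≤ (((⊤ : ℕ∞) : WithTop ℕ∞)) := by
  simp only [minSmoothness_of_isRCLikeNormedField]
  exact (WithTop.coe_le_coe.2 (le_top : (2 : ℕ∞) ≤ ⊤))

/-- Abstract data: a symmetric nondegenerate form with a hyperbolic pair and a further vector. -/
structure MHyp {E : Type*} [NormedAddCommGroup E] [NormedSpace ℝ E]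
    (g : E →L[ℝ] E →L[ℝ] ℝ) (ex ez y0 : E) : Prop where
  symm : ∀ v w, g v w = g w v
  nondeg : ∀ v, (∀ w, g v w = 0) → v = 0
  xx : g ex ex = 0
  zz : g ez ez = 0
  xz : g ex ez = -1
  yx : g y0 ex = 0
  yz : g y0 ez = 0
  yy : g y0 y0 ≠ 0

variable {E : Type*} [NormedAddCommGroup E] [NormedSpace ℝ E]
  {g : E →L[ℝ] E →L[ℝ] ℝ} {ex ez y0 : E}

lemma MHyp.decomp (H : MHyp g ex ez y0) (v : E) :
    ∃ a b : ℝ, ∃ y : E, g y ex = 0 ∧ g y ez = 0 ∧ v = a • ex + y + b • ez := by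
  refine ⟨-(g v ez), -(g v ex), v + (g v ez) • ex + (g v ex) • ez, ?_, ?_, ?_⟩
  · simp [H.xx, H.symm ez ex, H.xz]
  · simp [H.zz, H.xz]
  · module

lemma mquartic {a b c d e : ℝ} (h : ∀ t : ℝ, a + b * t + c * t ^ 2 + d * t ^ 3 + e * t ^ 4 = 0) :
    a = 0 ∧ b = 0 ∧ c = 0 ∧ d = 0 ∧ e = 0 := by
  have h0 := h 0
  have h1 := h 1
  have h2 := h (-1)
  have h3 := h 2
  have h4 := h (-2)
  norm_num at h0 h1 h2 h3 h4
  refine ⟨?_, ?_, ?_, ?_, ?_⟩ <;> linarith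

lemma MHyp.alg_conf (H : MHyp g ex ez y0) (h : E → E → ℝ)
    (hadd : ∀ u v w, h (u + v) w = h u w + h v w)
    (hsmul : ∀ (c : ℝ) v w, h (c • v) w = c * h v w)
    (hs : ∀ v w, h v w = h w v)
    (hN : ∀ p, g p ex = 0 → g p ez = 0 →
      h (ex + p + ((1 / 2) * g p p) • ez) (ex + p + ((1 / 2) * g p p) • ez) = 0) :
    ∀ v w, h v w = -(h ex ez) * g v w := by
  have hadd' : ∀ u v w, h w (u + v) = h w u + h w v := fun u v w => by
    rw [hs, hadd, hs u, hs v]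
  have hsmul' : ∀ (c : ℝ) v w, h w (c • v) = c * h w v := fun c v w => by
    rw [hs, hsmul, hs v]
  have key : ∀ p, g p ex = 0 → g p ez = 0 → h ex ex = 0 ∧ h ex p = 0 ∧
      h p p + g p p * h ex ez = 0 ∧ g p p * h p ez = 0 ∧ g p p ^ 2 * h ez ez = 0 := by
    intro p h1 h2
    have := mquartic (a := h ex ex) (b := 2 * h ex p) (c := h p p + g p p * h ex ez)
      (d := g p p * h p ez) (e := 1 / 4 * (g p p ^ 2 * h ez ez)) (fun t => by
        have := hN (t • p) (by simp [h1]) (by simp [h2])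
        simp only [hadd, hadd', hsmul, hsmul', map_smul, smul_apply,
          smul_eq_mul] at this
        rw [hs p ex, hs ez ex, hs ez p] at this
        linear_combination this)
    obtain ⟨q1, q2, q3, q4, q5⟩ := this
    exact ⟨q1, by linarith, q3, q4, by linarith⟩
  obtain ⟨k1, k2, k3, k4, k5⟩ := key y0 H.yx H.yz
  have hzz : h ez ez = 0 := by
    rcases mul_eq_zero.1 k5 with h' | h'
    · exact absurd (pow_eq_zero_iff (two_ne_zero) |>.1 h') H.yy
    · exact h'
  have hyz0 : h y0 ez = 0 := (mul_eq_zero.1 k4).resolve_left H.yy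
  have hpz : ∀ p, g p ex = 0 → g p ez = 0 → h p ez = 0 := by
    intro p h1 h2
    have a0 := (key p h1 h2).2.2.2.1
    have a1 := (key (p + y0) (by simp [h1, H.yx]) (by simp [h2, H.yz])).2.2.2.1
    have a2 := (key (p + (-1 : ℝ) • y0) (by simp [h1, H.yx]) (by simp [h2, H.yz])).2.2.2.1
    simp only [map_add, add_apply, hadd, hsmul, hyz0, map_smul,
      smul_apply, smul_eq_mul] at a0 a1 a2
    have : g y0 y0 * h p ez = 0 := by linear_combination (a1 + a2 - 2 * a0) / 2
    exact (mul_eq_zero.1 this).resolve_left H.yy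
  have hpp : ∀ p q, g p ex = 0 → g p ez = 0 → g q ex = 0 → g q ez = 0 →
      h p q = -(h ex ez) * g p q := by
    intro p q h1 h2 h3 h4
    have a1 := (key p h1 h2).2.2.1
    have a2 := (key q h3 h4).2.2.1
    have a3 := (key (p + q) (by simp [h1, h3]) (by simp [h2, h4])).2.2.1
    simp only [hadd, hadd', map_add, add_apply] at a3
    rw [hs q p, H.symm q p] at a3
    linear_combination (a3 - a1 - a2) / 2
  intro v w
  obtain ⟨a, b, p, p1, p2, rfl⟩ := H.decomp v
  obtain ⟨a', b', q, q1, q2, rfl⟩ := H.decomp w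
  simp only [hadd, hadd', hsmul, hsmul', map_add, add_apply, map_smul,
    smul_apply, smul_eq_mul, H.xx, H.zz, H.xz, k1, hzz, hpz p p1 p2,
    (key q q1 q2).2.1, H.symm ez ex, hs ez ex, hs p ex, (key p p1 p2).2.1, hs ez q, hpz q q1 q2,
    hpp p q p1 p2 q1 q2, p1, p2, H.symm ex q, H.symm ez q, q1, q2]
  ring

lemma MHyp.alg_hess (H : MHyp g ex ez y0) (h : E → E → ℝ)
    (hadd : ∀ u v w, h (u + v) w = h u w + h v w)
    (hsmul : ∀ (c : ℝ) v w, h (c • v) w = c * h v w)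
    (hs : ∀ v w, h v w = h w v)
    (hR : ∀ t w v z, h t w * g v z - h t z * g v w = h v w * g t z - h v z * g t w) :
    ∀ v w, h v w = 0 := by
  have hadd' : ∀ u v w, h w (u + v) = h w u + h w v := fun u v w => by
    rw [hs, hadd, hs u, hs v]
  have hsmul' : ∀ (c : ℝ) v w, h w (c • v) = c * h w v := fun c v w => by
    rw [hs, hsmul, hs v]
  have zx : g ez ex = -1 := by rw [H.symm, H.xz]
  have xy : g ex y0 = 0 := by rw [H.symm, H.yx]
  have zy : g ez y0 = 0 := by rw [H.symm, H.yz]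
  have hxx : h ex ex = 0 := by
    have := hR ex ex y0 y0
    simp only [H.yx, H.xx, xy] at this
    simpa [H.yy] using this
  have hzz : h ez ez = 0 := by
    have := hR ez ez y0 y0
    simp only [H.yz, H.zz, zy] at this
    simpa [H.yy] using this
  have hxz : h ex ez = 0 := by
    have := hR ex ex ez ez
    simp only [zx, H.xz, H.zz, H.xx, hs ez ex] at this
    linarith
  have hyx : ∀ p, g p ex = 0 → g p ez = 0 → h p ex = 0 := by
    intro p h1 h2
    have := hR ex ex p ez
    simp only [h1, h2, H.xz, H.xx] at this
    linarith
  have hyz : ∀ p, g p ex = 0 → g p ez = 0 → h p ez = 0 := by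
    intro p h1 h2
    have := hR ez ez p ex
    simp only [h1, h2, zx, H.zz] at this
    linarith
  have hyy : ∀ p q, g p ex = 0 → g p ez = 0 → g q ex = 0 → g q ez = 0 → h p q = 0 := by
    intro p q h1 h2 h3 h4
    have := hR ex ez p q
    simp only [h2, H.symm ex q, h3, H.xz, hxz] at this
    linarith
  intro v w
  obtain ⟨a, b, p, p1, p2, rfl⟩ := H.decomp v
  obtain ⟨a', b', q, q1, q2, rfl⟩ := H.decomp w
  simp only [hadd, hadd', hsmul, hsmul', hxx, hzz, hxz, hs ez ex, hyx p p1 p2, hyz p p1 p2,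
    hs ex q, hs ez q, hyx q q1 q2, hyz q q1 q2, hyy p q p1 p2 q1 q2]
  ring

theorem MHyp.killing (H : MHyp g ex ez y0) (F : E → E) (hF : ContDiff ℝ (⊤ : ℕ∞) F)
    (hN : ∀ u p, g p ex = 0 → g p ez = 0 →
      g (fderiv ℝ F u (ex + p + ((1 / 2) * g p p) • ez)) (ex + p + ((1 / 2) * g p p) • ez) = 0) :
    ∃ (t b : E) (S : E →L[ℝ] E) (c : ℝ), (∀ v w, g (S v) w = - g v (S w)) ∧
      ∀ u, F u = t + S u + c • u + (g b u) • u - ((1 / 2) * g u u) • b := by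
  set F' := fderiv ℝ F with hF'
  have cF' : ContDiff ℝ (⊤ : ℕ∞) F' := hF.fderiv_right (by simp)
  set F'' := fderiv ℝ F' with hF''
  have dF' : Differentiable ℝ F' := cF'.differentiable (by simp)
  have symF : ∀ u v w, F'' u v w = F'' u w v := fun u v w =>
    (hF.contDiffAt.isSymmSndFDerivAt mtwo_le) v w
  let L : E → E → (E →L[ℝ] E) →L[ℝ] ℝ := fun v w =>
    (g.flip w).comp (ContinuousLinearMap.apply ℝ E v)
  have hL : ∀ v w A, L v w A = g (A v) w := fun v w A => rfl
  let τ : E → ℝ := fun u => -(L ex ez + L ez ex) (F' u)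
  have cτ : ContDiff ℝ (⊤ : ℕ∞) τ := ((ContinuousLinearMap.contDiff _).comp cF').neg
  have hτ : ∀ u v w, g (F' u v) w + g v (F' u w) = τ u * g v w := by
    intro u
    have := H.alg_conf (fun v w => g (F' u v) w + g v (F' u w))
      (by intros; simp; ring) (by intros; simp; ring)
      (by intro v w; rw [H.symm (F' u v) w, H.symm v (F' u w)]; ring)
      (by
        intro p h1 h2
        have := hN u p h1 h2
        rw [H.symm _ (F' u _), this]; simp)
    intro v w
    rw [this]
    simp only [τ, add_apply, hL]
    rw [H.symm ex (F' u ez)]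
  set τ' := fderiv ℝ τ with hτ'
  have cτ' : ContDiff ℝ (⊤ : ℕ∞) τ' := cτ.fderiv_right (by simp)
  have dτ' : Differentiable ℝ τ' := cτ'.differentiable (by simp)
  have dτ : Differentiable ℝ τ := cτ.differentiable (by simp)
  have e1 : ∀ u t v w, g (F'' u t v) w + g v (F'' u t w) = τ' u t * g v w := by
    intro u t v w
    have a1 : HasFDerivAt (fun u => (L v w + L w v) (F' u)) ((L v w + L w v).comp (F'' u)) u :=
      (L v w + L w v).hasFDerivAt.comp u (dF' u).hasFDerivAt
    have a2 : HasFDerivAt (fun u => τ u * g v w) ((g v w) • τ' u) u :=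
      (dτ u).hasFDerivAt.mul_const _
    have a3 : (fun u => (L v w + L w v) (F' u)) = fun u => τ u * g v w := by
      ext u
      rw [← hτ u v w, H.symm v]; rfl
    rw [a3] at a1
    have := congrArg (fun l => l t) (a1.unique a2)
    simp [hL] at this
    rw [H.symm v]; linarith
  have kos : ∀ u v w z, g (F'' u v w) z =
      (1 / 2) * (τ' u v * g w z + τ' u w * g v z - τ' u z * g v w) := by
    intro u v w z
    have b1 := e1 u v w z
    have b2 := e1 u w v z
    have b3 := e1 u z v w
    rw [symF u w v] at b2
    rw [symF u z v, symF u z w] at b3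
    rw [H.symm w] at b1
    rw [H.symm v] at b2 b3
    rw [H.symm (F'' u w z) v] at b3
    rw [H.symm (F'' u w z) v] at b2
    linear_combination (b1 + b2 - b3) / 2
  set T := fderiv ℝ τ' with hT
  have symT : ∀ u v w, T u v w = T u w v := fun u v w =>
    (cτ.contDiffAt.isSymmSndFDerivAt mtwo_le) v w
  have T0 : ∀ u v w, T u v w = 0 := by
    intro u
    refine H.alg_hess (fun v w => T u v w) (by intros; simp) (by intros; simp) (symT u) ?_
    intro t w v z
    let φ : E → ℝ := fun u => L w z (F' u)
    have cφ : ContDiff ℝ (⊤ : ℕ∞) φ := (ContinuousLinearMap.contDiff _).comp cF'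
    have dφ : fderiv ℝ φ = fun u => (1 / 2 : ℝ) • ((g w z) • τ' u + (τ' u w) • (g.flip z)
        - (τ' u z) • (g.flip w)) := by
      ext u v
      have : HasFDerivAt φ ((L w z).comp (F'' u)) u :=
        (L w z).hasFDerivAt.comp u (dF' u).hasFDerivAt
      rw [this.fderiv]
      simp only [ContinuousLinearMap.comp_apply, hL, kos]
      simp
      ring
    have ddφ : ∀ t v, fderiv ℝ (fderiv ℝ φ) u t v =
        (1 / 2) * (T u t v * g w z + T u t w * g v z - T u t z * g v w) := by
      intro t v
      have h0 := (dτ' u).hasFDerivAt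
      have happ : ∀ w, HasFDerivAt (fun u => τ' u w)
          ((ContinuousLinearMap.apply ℝ ℝ w).comp (T u)) u := fun w =>
        (ContinuousLinearMap.apply ℝ ℝ w).hasFDerivAt.comp u h0
      have := (((h0.const_smul (g w z)).add ((happ w).smul_const (g.flip z))).sub
        ((happ z).smul_const (g.flip w))).const_smul (1 / 2 : ℝ)
      rw [dφ]
      have h2 := this.fderiv
      have h3 := congrArg (fun l => l t v) h2
      refine Eq.trans h3 ?_
      simp
      ring
    have hs : fderiv ℝ (fderiv ℝ φ) u t v = fderiv ℝ (fderiv ℝ φ) u v t :=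
      (cφ.contDiffAt.isSymmSndFDerivAt mtwo_le) t v
    rw [ddφ, ddφ, symT u v t] at hs
    linear_combination 2 * hs
  have τc : ∀ u, τ' u = τ' 0 := fun u =>
    is_const_of_fderiv_eq_zero dτ' (fun u => by ext v w; exact T0 u v w) u 0
  set β := τ' 0 with hβ
  let b : E := (g y0 y0)⁻¹ • ((2 * β y0) • y0 - (2 : ℝ) • F'' 0 y0 y0)
  have hb : ∀ z, g b z = β z := by
    intro z
    simp only [b, map_smul, map_sub, smul_apply, sub_apply,
      smul_eq_mul, kos]
    have := H.yy
    field_simp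
    ring
  have F''c : ∀ u v w, F'' u v w = (1 / 2 : ℝ) • (β v • w + β w • v - g v w • b) := by
    intro u v w
    rw [← sub_eq_zero]
    apply H.nondeg
    intro z
    simp only [map_smul, map_sub, map_add, smul_apply,
      sub_apply, add_apply,
      smul_eq_mul, kos, hb, τc]
    ring
  have F'lin : ∀ u, F' u = F' 0 + F'' 0 u := by
    intro u
    have : ∀ u, F' u - F'' 0 u = F' 0 - F'' 0 0 := fun u =>
      is_const_of_fderiv_eq_zero (f := fun u => F' u - F'' 0 u)
        (dF'.sub (F'' 0).differentiable) (fun u => by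
          have := ((dF' u).hasFDerivAt.sub (F'' 0).hasFDerivAt).fderiv
          refine Eq.trans this ?_
          ext v w
          simp [← hF'', F''c]) u 0
    have := this u
    rw [map_zero, sub_zero] at this
    rw [← this]; abel
  have Fq : ∀ u, F u = F 0 + F' 0 u + (1 / 2 : ℝ) • F'' 0 u u := by
    intro u
    have hd : ∀ u, HasFDerivAt (fun u => F u - (F' 0 u + (1 / 2 : ℝ) • F'' 0 u u))
        (0 : E →L[ℝ] E) u := by
      intro u
      have h1 := ((hF.differentiable (by simp)) u).hasFDerivAt
      have h2 := ((F' 0).hasFDerivAt (x := u))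
      have h3 := ((F'' 0).hasFDerivAt (x := u)).clm_apply (hasFDerivAt_id (𝕜 := ℝ) u)
      have h4 := h1.sub (h2.add (h3.const_smul (1 / 2 : ℝ)))
      refine h4.congr_fderiv ?_
      ext v
      rw [← hF', F'lin u]
      simp
      rw [symF 0 v u]
      module
    have := is_const_of_fderiv_eq_zero (fun u => (hd u).differentiableAt)
      (fun u => (hd u).fderiv) u 0
    simp at this
    rw [sub_eq_iff_eq_add] at this
    rw [this]; module
  refine ⟨F 0, (1 / 2 : ℝ) • b, F' 0 - (τ 0 / 2) • ContinuousLinearMap.id ℝ E, τ 0 / 2, ?_, ?_⟩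
  · intro v w
    have := hτ 0 v w
    simp
    linear_combination this
  · intro u
    rw [Fq, F''c]
    simp [hb]
    module

end AbstractConformal

section MoebiusFields

variable {E : Type*} [NormedAddCommGroup E] [NormedSpace ℝ E]

/-- The null embedding. -/
noncomputable def mio (g : E →L[ℝ] E →L[ℝ] ℝ) (u : E) : ℝ × E × ℝ := (1, u, (1 / 2) * g u u)

/-- The derivative of the null embedding. -/
noncomputable def mJ (g : E →L[ℝ] E →L[ℝ] ℝ) (u : E) : E →L[ℝ] ℝ × E × ℝ :=
  (0 : E →L[ℝ] ℝ).prod ((ContinuousLinearMap.id ℝ E).prod (g u))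

/-- The ambient form. -/
noncomputable def mG (g : E →L[ℝ] E →L[ℝ] ℝ) (a b : ℝ × E × ℝ) : ℝ :=
  g a.2.1 b.2.1 - a.1 * b.2.2 - a.2.2 * b.1

/-- The conformal vector field of an endomorphism of the ambient space. -/
noncomputable def mvf (g : E →L[ℝ] E →L[ℝ] ℝ) (A : (ℝ × E × ℝ) →L[ℝ] (ℝ × E × ℝ)) (u : E) : E :=
  (A (mio g u)).2.1 - (A (mio g u)).1 • u

/-- Its derivative. -/
noncomputable def mvfD (g : E →L[ℝ] E →L[ℝ] ℝ) (A : (ℝ × E × ℝ) →L[ℝ] (ℝ × E × ℝ)) (u : E) :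
    E →L[ℝ] E :=
  ((ContinuousLinearMap.fst ℝ E ℝ).comp (ContinuousLinearMap.snd ℝ ℝ (E × ℝ))).comp
    (A.comp (mJ g u)) -
  ((A (mio g u)).1 • ContinuousLinearMap.id ℝ E +
    ((ContinuousLinearMap.fst ℝ ℝ (E × ℝ)).comp (A.comp (mJ g u))).smulRight u)

lemma mvfD_apply (g : E →L[ℝ] E →L[ℝ] ℝ) (A : (ℝ × E × ℝ) →L[ℝ] (ℝ × E × ℝ)) (u v : E) :
    mvfD g A u v = (A (0, v, g u v)).2.1 - ((A (mio g u)).1 • v + (A (0, v, g u v)).1 • u) := by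
  simp [mvfD, mJ]

variable {g : E →L[ℝ] E →L[ℝ] ℝ} {ex ez y0 : E}

lemma MHyp.hasFDerivAt_mio (H : MHyp g ex ez y0) (u : E) : HasFDerivAt (mio g) (mJ g u) u := by
  have h1 : HasFDerivAt (fun u : E => (1 / 2 : ℝ) * g u u) (g u) u := by
    have := ((g.hasFDerivAt (x := u)).clm_apply (hasFDerivAt_id (𝕜 := ℝ) u)).const_smul (1 / 2 : ℝ)
    refine this.congr_fderiv ?_
    ext v
    simp
    rw [H.symm v u]; ring
  exact (hasFDerivAt_const (1 : ℝ) u).prodMk ((hasFDerivAt_id u).prodMk h1)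

lemma MHyp.hasFDerivAt_mvf (H : MHyp g ex ez y0) (A : (ℝ × E × ℝ) →L[ℝ] (ℝ × E × ℝ)) (u : E) :
    HasFDerivAt (mvf g A) (mvfD g A u) u := by
  have h1 := A.hasFDerivAt.comp u (H.hasFDerivAt_mio u)
  have h2 := (ContinuousLinearMap.fst ℝ ℝ (E × ℝ)).hasFDerivAt.comp u h1
  have h3 := ((ContinuousLinearMap.fst ℝ E ℝ).comp
    (ContinuousLinearMap.snd ℝ ℝ (E × ℝ))).hasFDerivAt.comp u h1
  exact h3.sub (h2.smul (hasFDerivAt_id u))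

lemma mvf_contDiff (g : E →L[ℝ] E →L[ℝ] ℝ) (A : (ℝ × E × ℝ) →L[ℝ] (ℝ × E × ℝ)) :
    ContDiff ℝ (⊤ : ℕ∞) (mvf g A) := by
  have h0 : ContDiff ℝ (⊤ : ℕ∞) (mio g) := by
    unfold mio
    exact contDiff_const.prodMk (contDiff_id.prodMk
      (contDiff_const.mul (g.contDiff.clm_apply contDiff_id)))
  have h1 := A.contDiff.comp h0
  exact (h1.snd.fst).sub (h1.fst.smul contDiff_id)

/-- Skewness with respect to the ambient form. -/
def MSkew (g : E →L[ℝ] E →L[ℝ] ℝ) (A : (ℝ × E × ℝ) →L[ℝ] (ℝ × E × ℝ)) : Prop :=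
  ∀ a b, mG g (A a) b = - mG g a (A b)

lemma MHyp.mvf_killing (H : MHyp g ex ez y0) {A : (ℝ × E × ℝ) →L[ℝ] (ℝ × E × ℝ)} (hA : MSkew g A)
    (u v : E) : g (mvfD g A u v) v = -(A (mio g u)).1 * g v v := by
  have := hA (0, v, g u v) (0, v, g u v)
  rw [mvfD_apply]
  simp only [mG] at this
  rw [H.symm v] at this
  simp only [map_sub, map_add, map_smul, sub_apply, add_apply, smul_apply, smul_eq_mul]
  linear_combination (1 / 2) * this

lemma MHyp.mvf_I1 (H : MHyp g ex ez y0) {A : (ℝ × E × ℝ) →L[ℝ] (ℝ × E × ℝ)} (hA : MSkew g A)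
    (u : E) : A (mio g u) = (A (mio g u)).1 • mio g u + (0, mvf g A u, g u (mvf g A u)) := by
  have := hA (mio g u) (mio g u)
  simp only [mG] at this
  rw [H.symm (mio g u).2.1] at this
  refine Prod.ext ?_ (Prod.ext ?_ ?_)
  · simp [mio]
  · simp [mvf, mio]
  · simp only [mvf, map_sub, map_smul, smul_eq_mul, Prod.snd_add, Prod.smul_snd]
    rw [H.symm u]
    have e1 : (mio g u).2.1 = u := rfl
    have e2 : (mio g u).1 = 1 := rfl
    have e3 : (mio g u).2.2 = (1 / 2) * g u u := rfl
    rw [e1, e2, e3] at this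
    rw [e3]
    linear_combination (- 1 / 2) * this

lemma MHyp.mvf_bracket (H : MHyp g ex ez y0) {A B : (ℝ × E × ℝ) →L[ℝ] (ℝ × E × ℝ)}
    (hA : MSkew g A) (hB : MSkew g B) (u : E) :
    mvf g (A.comp B - B.comp A) u = mvfD g A u (mvf g B u) - mvfD g B u (mvf g A u) := by
  rw [mvfD_apply, mvfD_apply]
  conv_lhs => unfold mvf
  simp only [sub_apply, ContinuousLinearMap.comp_apply]
  have e1 : A (B (mio g u)) = (B (mio g u)).1 • A (mio g u) +
      A (0, mvf g B u, g u (mvf g B u)) := by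
    conv_lhs => rw [H.mvf_I1 hB u]
    simp
  have e2 : B (A (mio g u)) = (A (mio g u)).1 • B (mio g u) +
      B (0, mvf g A u, g u (mvf g A u)) := by
    conv_lhs => rw [H.mvf_I1 hA u]
    simp
  rw [e1, e2]
  generalize hx : A (0, mvf g B u, g u (mvf g B u)) = x
  generalize hy : B (0, mvf g A u, g u (mvf g A u)) = y
  simp only [mvf, Prod.fst_sub, Prod.snd_sub, Prod.fst_add, Prod.snd_add, Prod.smul_fst,
    Prod.smul_snd, smul_eq_mul]
  module

lemma MHyp.mvf_inj (H : MHyp g ex ez y0) {A : (ℝ × E × ℝ) →L[ℝ] (ℝ × E × ℝ)}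
    (hA : MSkew g A) (h0 : mvf g A = 0) : A = 0 := by
  have hD : ∀ u, mvfD g A u = 0 := by
    intro u
    have := (H.hasFDerivAt_mvf A u).fderiv
    rw [h0] at this
    rw [← this]
    exact fderiv_const_apply 0
  have hmu : ∀ u, (A (mio g u)).1 = 0 := by
    intro u
    have := H.mvf_killing hA u y0
    rw [hD u] at this
    simpa [H.yy] using this
  have hio : ∀ u, A (mio g u) = 0 := by
    intro u
    rw [H.mvf_I1 hA u, hmu u, h0]
    simp
  have a0 : A (1, 0, 0) = 0 := by simpa [mio] using hio 0
  have a1 : ∀ v : E, A (0, v, 0) = 0 := by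
    intro v
    have : ((0 : ℝ), v, (0 : ℝ)) = (1 / 2 : ℝ) • (mio g v - mio g (-v)) := by
      refine Prod.ext ?_ (Prod.ext ?_ ?_)
      · simp [mio]
      · simp only [mio, Prod.smul_snd, Prod.snd_sub, Prod.fst_sub, Prod.smul_fst]; module
      · simp [mio]
    rw [this, map_smul, map_sub, hio, hio]; simp
  have a2 : A (0, 0, 1) = 0 := by
    have : ((0 : ℝ), (0 : E), (1 : ℝ)) =
        (2 / g y0 y0) • (mio g y0 - ((1 : ℝ), (0 : E), (0 : ℝ)) - ((0 : ℝ), y0, (0 : ℝ))) := by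
      have := H.yy
      refine Prod.ext ?_ (Prod.ext ?_ ?_)
      · simp [mio]
      · simp [mio]
      · simp [mio]; field_simp
    rw [this, map_smul, map_sub, map_sub, hio, a0, a1]; simp
  refine ContinuousLinearMap.ext ?_
  rintro ⟨a, v, d⟩
  have : (a, v, d) = a • ((1 : ℝ), (0 : E), (0 : ℝ)) + ((0 : ℝ), v, (0 : ℝ)) +
      d • ((0 : ℝ), (0 : E), (1 : ℝ)) := by
    refine Prod.ext ?_ (Prod.ext ?_ ?_) <;> simp
  rw [this, map_add, map_add, map_smul, map_smul, a0, a1, a2]; simp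

lemma MHyp.mvf_surj (H : MHyp g ex ez y0) (t b : E) (S : E →L[ℝ] E) (c : ℝ)
    (hS : ∀ v w, g (S v) w = - g v (S w)) :
    ∃ A : (ℝ × E × ℝ) →L[ℝ] (ℝ × E × ℝ), MSkew g A ∧
      ∀ u, mvf g A u = t + S u + c • u + (g b u) • u - ((1 / 2) * g u u) • b := by
  let p1 := ContinuousLinearMap.fst ℝ ℝ (E × ℝ)
  let p2 := (ContinuousLinearMap.fst ℝ E ℝ).comp (ContinuousLinearMap.snd ℝ ℝ (E × ℝ))
  let p3 := (ContinuousLinearMap.snd ℝ E ℝ).comp (ContinuousLinearMap.snd ℝ ℝ (E × ℝ))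
  let A : (ℝ × E × ℝ) →L[ℝ] (ℝ × E × ℝ) :=
    ((-c) • p1 - (g b).comp p2).prod
      ((p1.smulRight t + S.comp p2 - p3.smulRight b).prod ((g t).comp p2 + c • p3))
  have hAa : ∀ a, A a = (-c * a.1 - g b a.2.1, a.1 • t + S a.2.1 - a.2.2 • b,
      g t a.2.1 + c * a.2.2) := fun a => by simp [A, p1, p2, p3]
  refine ⟨A, ?_, ?_⟩
  · intro x y
    simp only [mG, hAa, map_sub, map_add, map_smul, sub_apply, add_apply, smul_apply, smul_eq_mul,
      hS]
    rw [H.symm x.2.1 t, H.symm x.2.1 b]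
    ring
  · intro u
    simp only [mvf, hAa, mio]
    module

end MoebiusFields

section MongeGeometry

/-- The base space with coordinates `(x, y, z)`. -/
abbrev ME (m : ℕ) := ℝ × (Fin m → ℝ) × ℝ

/-- The bilinear form of `κ`. -/
noncomputable def mkap {m : ℕ} (κ : Fin m → Fin m → ℝ) :
    (Fin m → ℝ) →L[ℝ] (Fin m → ℝ) →L[ℝ] ℝ :=
  LinearMap.toContinuousBilinearMap (Matrix.toBilin' (Matrix.of κ))

lemma mkap_apply {m : ℕ} (κ : Fin m → Fin m → ℝ) (p q : Fin m → ℝ) :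
    mkap κ p q = ∑ i, ∑ j, κ i j * p i * q j := by
  simp only [mkap, LinearMap.toContinuousBilinearMap_apply, Matrix.toBilin'_apply, Matrix.of_apply]
  refine Finset.sum_congr rfl fun i _ => Finset.sum_congr rfl fun j _ => by ring

lemma mkap_symm {m : ℕ} {κ : Fin m → Fin m → ℝ} (hs : ∀ i j, κ i j = κ j i) (p q : Fin m → ℝ) :
    mkap κ p q = mkap κ q p := by
  rw [mkap_apply, mkap_apply, Finset.sum_comm]
  refine Finset.sum_congr rfl fun i _ => Finset.sum_congr rfl fun j _ => by rw [hs]; ring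

/-- Projection to the base. -/
noncomputable def mpi (m : ℕ) : MPt m →L[ℝ] ME m :=
  (ContinuousLinearMap.proj MCo.x).prod
    ((ContinuousLinearMap.pi fun i => ContinuousLinearMap.proj (MCo.y i)).prod
      (ContinuousLinearMap.proj MCo.z))

/-- The fibre coordinates. -/
noncomputable def mpp (m : ℕ) : MPt m →L[ℝ] (Fin m → ℝ) :=
  ContinuousLinearMap.pi fun i => ContinuousLinearMap.proj (MCo.p i)

/-- A point from its base and fibre coordinates. -/
noncomputable def mmk (m : ℕ) : (ME m × (Fin m → ℝ)) →L[ℝ] MPt m :=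
  ContinuousLinearMap.pi fun c => match c with
    | MCo.x => (ContinuousLinearMap.fst ℝ _ _).comp (ContinuousLinearMap.fst ℝ _ _)
    | MCo.y i => (ContinuousLinearMap.proj i).comp ((ContinuousLinearMap.fst ℝ _ _).comp
        ((ContinuousLinearMap.snd ℝ _ _).comp (ContinuousLinearMap.fst ℝ _ _)))
    | MCo.z => (ContinuousLinearMap.snd ℝ _ _).comp
        ((ContinuousLinearMap.snd ℝ _ _).comp (ContinuousLinearMap.fst ℝ _ _))
    | MCo.p i => (ContinuousLinearMap.proj i).comp (ContinuousLinearMap.snd ℝ _ _)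

variable {m : ℕ}

@[simp] lemma mpi_mmk (u : ME m) (p : Fin m → ℝ) : mpi m (mmk m (u, p)) = u := rfl
@[simp] lemma mpp_mmk (u : ME m) (p : Fin m → ℝ) : mpp m (mmk m (u, p)) = p := rfl
@[simp] lemma mmk_eta (q : MPt m) : mmk m (mpi m q, mpp m q) = q := by
  ext c; cases c <;> rfl

lemma mext {q q' : MPt m} (h : mpi m q = mpi m q') (h' : mpp m q = mpp m q') : q = q' := by
  rw [← mmk_eta q, ← mmk_eta q', h, h']

/-- The null direction determined by `p`. -/
noncomputable def mNN (κ : Fin m → Fin m → ℝ) (p : Fin m → ℝ) : ME m :=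
  (1, p, (1 / 2) * mkap κ p p)

/-- The derivative of `mNN`. -/
noncomputable def mdN (κ : Fin m → Fin m → ℝ) (p : Fin m → ℝ) : (Fin m → ℝ) →L[ℝ] ME m :=
  (0 : (Fin m → ℝ) →L[ℝ] ℝ).prod ((ContinuousLinearMap.id ℝ _).prod (mkap κ p))

lemma mdN_apply (κ : Fin m → Fin m → ℝ) (p e : Fin m → ℝ) : mdN κ p e = (0, e, mkap κ p e) := rfl

lemma hasFDerivAt_mNN {κ : Fin m → Fin m → ℝ} (hs : ∀ i j, κ i j = κ j i) (p : Fin m → ℝ) :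
    HasFDerivAt (mNN κ) (mdN κ p) p := by
  have h1 : HasFDerivAt (fun u => (1 / 2 : ℝ) * mkap κ u u) (mkap κ p) p := by
    have := (((mkap κ).hasFDerivAt (x := p)).clm_apply
      (hasFDerivAt_id (𝕜 := ℝ) p)).const_smul (1 / 2 : ℝ)
    refine this.congr_fderiv ?_
    refine ContinuousLinearMap.ext fun v => ?_
    simp
    rw [mkap_symm hs v p]; ring
  exact (hasFDerivAt_const (1 : ℝ) p).prodMk ((hasFDerivAt_id p).prodMk h1)

lemma mNN_contDiff (κ : Fin m → Fin m → ℝ) : ContDiff ℝ (⊤ : ℕ∞) (mNN κ) := by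
  unfold mNN
  exact contDiff_const.prodMk (contDiff_id.prodMk
      (contDiff_const.mul ((mkap κ).contDiff.clm_apply contDiff_id)))

lemma mDx_eq (κ : Fin m → Fin m → ℝ) (q : MPt m) : mDx m κ q = mmk m (mNN κ (mpp m q), 0) := by
  ext c
  have : ∀ c, mDx m κ q c = munit m MCo.x c + (∑ i : Fin m, q (MCo.p i) * munit m (MCo.y i) c) +
    ((1 / 2) * ∑ i : Fin m, ∑ j : Fin m, κ i j * q (MCo.p i) * q (MCo.p j)) * munit m MCo.z c := by
    intro c
    simp [mDx, Finset.sum_apply]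
  rw [this]
  cases c
  · simp [munit, mmk, mNN]
  · simp [munit, mmk, mNN, mpp]
  · simp [munit, mmk, mNN, mkap_apply, mpp]
  · simp [munit, mmk]

lemma mem_mDist (κ : Fin m → Fin m → ℝ) (q w : MPt m) :
    w ∈ mDist m κ q ↔ mpi m w = (mpi m w).1 • mNN κ (mpp m q) := by
  constructor
  · intro h
    refine Submodule.span_induction (p := fun w _ => mpi m w = (mpi m w).1 • mNN κ (mpp m q))
      ?_ ?_ ?_ ?_ h
    · rintro w (rfl | ⟨i, rfl⟩)
      · rw [mDx_eq, mpi_mmk]; simp [mNN]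
      · have : mpi m (munit m (MCo.p i)) = 0 := by
          refine Prod.ext ?_ (Prod.ext ?_ ?_)
          · simp [mpi, munit]
          · ext j; simp [mpi, munit]
          · simp [mpi, munit]
        simp [this]
    · simp
    · intro a b _ _ ha hb
      rw [map_add, Prod.fst_add, add_smul, ← ha, ← hb]
    · intro c a _ ha
      rw [map_smul, Prod.smul_fst, smul_eq_mul, mul_smul, ← ha]
  · intro h
    have : w = (mpi m w).1 • mDx m κ q + ∑ i, mpp m w i • munit m (MCo.p i) := by
      have h1 : (∑ i, mpp m w i • munit m (MCo.p i)) = mmk m (0, mpp m w) := by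
        ext c
        rw [Finset.sum_apply]
        cases c <;> simp [munit, mmk]
      rw [h1, mDx_eq, ← map_smul, ← map_add]
      conv_lhs => rw [← mmk_eta w]
      congr 1
      refine Prod.ext ?_ ?_
      · simpa using h
      · simp
    rw [this]
    refine Submodule.add_mem _ (Submodule.smul_mem _ _ (Submodule.subset_span (Or.inl rfl))) ?_
    exact Submodule.sum_mem _ fun i _ => Submodule.smul_mem _ _
      (Submodule.subset_span (Or.inr ⟨i, rfl⟩))

lemma msection_deriv {κ : Fin m → Fin m → ℝ} (hs : ∀ i j, κ i j = κ j i) {W : MPt m → MPt m}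
    (hW : Differentiable ℝ W) (hsec : ∀ q, mpi m (W q) = (mpi m (W q)).1 • mNN κ (mpp m q))
    (q v : MPt m) :
    mpi m (fderiv ℝ W q v) = (mpi m (fderiv ℝ W q v)).1 • mNN κ (mpp m q) +
      (mpi m (W q)).1 • mdN κ (mpp m q) (mpp m v) := by
  have h1 : HasFDerivAt (fun q => mpi m (W q)) ((mpi m).comp (fderiv ℝ W q)) q :=
    (mpi m).hasFDerivAt.comp q (hW q).hasFDerivAt
  have h2 := (ContinuousLinearMap.fst ℝ _ _).hasFDerivAt.comp q h1
  have h3 := (hasFDerivAt_mNN hs (mpp m q)).comp q (mpp m).hasFDerivAt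
  have h4 := h2.smul h3
  have h5 : (fun q => mpi m (W q)) = fun q => (mpi m (W q)).1 • mNN κ (mpp m q) :=
    funext hsec
  rw [h5] at h1
  have := congrArg (fun l => l v) (h1.unique h4)
  simp at this
  rw [this]
  simp [mNN, mdN_apply, add_comm]

/-- Pointwise characterization of symmetries. -/
lemma mem_mSym_iff {κ : Fin m → Fin m → ℝ} (hs : ∀ i j, κ i j = κ j i) (X : MPt m → MPt m) :
    X ∈ mSym m κ ↔ ContDiff ℝ (⊤ : ℕ∞) X ∧ ∀ q w, mpi m w = (mpi m w).1 • mNN κ (mpp m q) →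
      mpi m (fderiv ℝ X q w) - (mpi m (fderiv ℝ X q w)).1 • mNN κ (mpp m q) =
        (mpi m w).1 • mdN κ (mpp m q) (mpp m (X q)) := by
  have key : ∀ W : MPt m → MPt m, ContDiff ℝ (⊤ : ℕ∞) W → (∀ q, W q ∈ mDist m κ q) → ∀ q,
      (mBr m X W q ∈ mDist m κ q ↔
      mpi m (fderiv ℝ X q (W q)) - (mpi m (fderiv ℝ X q (W q))).1 • mNN κ (mpp m q) =
        (mpi m (W q)).1 • mdN κ (mpp m q) (mpp m (X q))) := by
    intro W hW hsec q
    have := msection_deriv hs (hW.differentiable (by simp))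
      (fun q => (mem_mDist κ q (W q)).1 (hsec q)) q (X q)
    rw [mem_mDist]
    simp only [mBr, map_sub, Prod.fst_sub]
    generalize mpi m (fderiv ℝ W q (X q)) = a at *
    generalize mpi m (fderiv ℝ X q (W q)) = b at *
    rw [sub_smul, sub_eq_sub_iff_sub_eq_sub, eq_comm]
    rw [← sub_eq_iff_eq_add'] at this
    rw [this]
  constructor
  · rintro ⟨hX, h⟩
    refine ⟨hX, fun q w hw => ?_⟩
    let W : MPt m → MPt m := fun q' => mmk m ((mpi m w).1 • mNN κ (mpp m q'), mpp m w)
    have hW : ContDiff ℝ (⊤ : ℕ∞) W :=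
      (mmk m).contDiff.comp ((((mNN_contDiff κ).comp
        (mpp m).contDiff).const_smul (mpi m w).1).prodMk contDiff_const)
    have hsec : ∀ q, W q ∈ mDist m κ q := fun q => by
      rw [mem_mDist]; simp [W, mNN]
    have hq : W q = w := by simp only [W, ← hw, mmk_eta]
    have := (key W hW hsec q).1 (h W hW hsec q)
    rwa [hq] at this
  · rintro ⟨hX, h⟩
    exact ⟨hX, fun W hW hsec q => (key W hW hsec q).2 (h q _ ((mem_mDist κ q _).1 (hsec q)))⟩

lemma mSym_projectable (hm : 2 ≤ m) {κ : Fin m → Fin m → ℝ} (hs : ∀ i j, κ i j = κ j i)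
    {X : MPt m → MPt m} (hX : X ∈ mSym m κ) (q d : MPt m) (hd : mpi m d = 0) :
    mpi m (fderiv ℝ X q d) = 0 := by
  obtain ⟨cX, h⟩ := (mem_mSym_iff hs X).1 hX
  let ψ : MPt m → ME m := fun q => mpi m (X q)
  have cψ : ContDiff ℝ (⊤ : ℕ∞) ψ := (mpi m).contDiff.comp cX
  have hψ : ∀ q v, fderiv ℝ ψ q v = mpi m (fderiv ℝ X q v) := by
    intro q v
    have : HasFDerivAt ψ ((mpi m).comp (fderiv ℝ X q)) q :=
      (mpi m).hasFDerivAt.comp q (cX.differentiable (by simp) q).hasFDerivAt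
    rw [this.fderiv]; rfl
  set ψ' := fderiv ℝ ψ with hψ'
  have cψ' : ContDiff ℝ (⊤ : ℕ∞) ψ' := cψ.fderiv_right (by simp)
  have e1 : ∀ q d, mpi m d = 0 → ψ' q d = (ψ' q d).1 • mNN κ (mpp m q) := by
    intro q d hd
    have := h q d (by simp [hd])
    rw [hd] at this
    rw [hψ]
    simpa [sub_eq_zero] using this
  have e2 : ∀ q d d', mpi m d = 0 → fderiv ℝ ψ' q d' d =
      (fderiv ℝ ψ' q d' d).1 • mNN κ (mpp m q) + (ψ' q d).1 • mdN κ (mpp m q) (mpp m d') := by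
    intro q d d' hd
    have h1 : HasFDerivAt (fun q => ψ' q d)
        ((ContinuousLinearMap.apply ℝ (ME m) d).comp (fderiv ℝ ψ' q)) q :=
      (ContinuousLinearMap.apply ℝ (ME m) d).hasFDerivAt.comp q
        (cψ'.differentiable (by simp) q).hasFDerivAt
    have h2 := (ContinuousLinearMap.fst ℝ _ _).hasFDerivAt.comp q h1
    have h3 := (hasFDerivAt_mNN hs (mpp m q)).comp q (mpp m).hasFDerivAt
    have h4 := h2.smul h3
    have h5 : (fun q => ψ' q d) = fun q => (ψ' q d).1 • mNN κ (mpp m q) :=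
      funext fun q => e1 q d hd
    rw [h5] at h1
    have := congrArg (fun l => l d') (h1.unique h4)
    simp at this
    exact this.trans (add_comm _ _)
  have e3 : ∀ q d d', mpi m d = 0 → mpi m d' = 0 →
      (ψ' q d).1 • mpp m d' = (ψ' q d').1 • mpp m d := by
    intro q d d' hd hd'
    have s : fderiv ℝ ψ' q d' d = fderiv ℝ ψ' q d d' :=
      (cψ.contDiffAt.isSymmSndFDerivAt mtwo_le) d' d
    have a1 := e2 q d d' hd
    have a2 := e2 q d' d hd'
    rw [s] at a1
    have a3 := a1.symm.trans a2
    rw [add_right_inj] at a3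
    have := congrArg (fun v : ME m => v.2.1) a3
    simpa [mdN_apply] using this
  have e4 : ∀ q i, ψ' q (mmk m (0, Pi.single i 1)) = 0 := by
    intro q i
    obtain ⟨k, hk⟩ : ∃ k : Fin m, k ≠ i := by
      have : Nontrivial (Fin m) := Fin.nontrivial_iff_two_le.2 hm
      exact exists_ne i
    have := congrFun (e3 q (mmk m (0, Pi.single i 1)) (mmk m (0, Pi.single k 1)) rfl rfl) k
    rw [e1 q _ rfl]
    simp [hk] at this
    rw [this, zero_smul]
  rw [← hψ]
  have hdd : d = ∑ i, (mpp m d i) • mmk m (0, Pi.single i 1) := by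
    conv_lhs => rw [← mmk_eta d, hd]
    simp only [← map_smul, ← map_sum]
    congr 1
    refine Prod.ext ?_ ?_
    · simp [Prod.fst_sum]
    · ext j
      simp [Prod.snd_sum, Finset.sum_apply, Pi.single_apply]
  rw [hdd, map_sum]
  exact Finset.sum_eq_zero fun i _ => by rw [map_smul, e4, smul_zero]

/-- Symmetries are the lifts of fields on the base. -/
lemma mSym_iff_lift (hm : 2 ≤ m) {κ : Fin m → Fin m → ℝ} (hs : ∀ i j, κ i j = κ j i)
    (X : MPt m → MPt m) :
    X ∈ mSym m κ ↔ ContDiff ℝ (⊤ : ℕ∞) X ∧ ∃ F : ME m → ME m, ContDiff ℝ (⊤ : ℕ∞) F ∧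
      (∀ q, mpi m (X q) = F (mpi m q)) ∧
      ∀ q, fderiv ℝ F (mpi m q) (mNN κ (mpp m q)) -
        (fderiv ℝ F (mpi m q) (mNN κ (mpp m q))).1 • mNN κ (mpp m q) =
          mdN κ (mpp m q) (mpp m (X q)) := by
  have chain : ∀ F : ME m → ME m, ContDiff ℝ (⊤ : ℕ∞) F → ContDiff ℝ (⊤ : ℕ∞) X →
      (∀ q, mpi m (X q) = F (mpi m q)) → ∀ q w,
      mpi m (fderiv ℝ X q w) = fderiv ℝ F (mpi m q) (mpi m w) := by
    intro F cF cX h q w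
    have h1 : HasFDerivAt (fun q => mpi m (X q)) ((mpi m).comp (fderiv ℝ X q)) q :=
      (mpi m).hasFDerivAt.comp q (cX.differentiable (by simp) q).hasFDerivAt
    have h2 : HasFDerivAt (fun q => F (mpi m q)) ((fderiv ℝ F (mpi m q)).comp (mpi m)) q :=
      (cF.differentiable (by simp) _).hasFDerivAt.comp q (mpi m).hasFDerivAt
    rw [funext h] at h1
    exact congrArg (fun l => l w) (h1.unique h2)
  constructor
  · intro hX
    obtain ⟨cX, h⟩ := (mem_mSym_iff hs X).1 hX
    have cF : ContDiff ℝ (⊤ : ℕ∞) (fun u : ME m => mpi m (X (mmk m (u, 0)))) :=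
      (mpi m).contDiff.comp (cX.comp ((mmk m).contDiff.comp (contDiff_id.prodMk contDiff_const)))
    have hF : ∀ q, mpi m (X q) = (fun u : ME m => mpi m (X (mmk m (u, 0)))) (mpi m q) := by
      intro q
      let d : MPt m := mmk m (0, mpp m q)
      have hd : mpi m d = 0 := rfl
      have hder : ∀ t : ℝ, HasDerivAt (fun t : ℝ => mpi m (X (mmk m (mpi m q, 0) + t • d)))
          0 t := by
        intro t
        have h1 : HasDerivAt (fun t : ℝ => mmk m (mpi m q, 0) + t • d) d t := by
          simpa using ((hasDerivAt_id t).smul_const d).const_add (mmk m (mpi m q, 0))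
        have h2 := ((cX.differentiable (by simp) _).hasFDerivAt).comp_hasDerivAt t h1
        have h3 := (mpi m).hasFDerivAt.comp_hasDerivAt t h2
        rw [mSym_projectable hm hs hX _ d hd] at h3
        exact h3
      have := is_const_of_deriv_eq_zero (fun t => (hder t).differentiableAt)
        (fun t => (hder t).deriv) 1 0
      have hq : mmk m (mpi m q, 0) + (1 : ℝ) • d = q := by
        conv_rhs => rw [← mmk_eta q]
        simp only [d, one_smul, ← map_add]
        simp
      beta_reduce at this
      rw [hq] at this
      simpa using this
    refine ⟨cX, _, cF, hF, ?_⟩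
    intro q
    have := h q (mmk m (mNN κ (mpp m q), 0)) (by simp [mNN])
    rw [chain _ cF cX hF, mpi_mmk] at this
    rw [this]
    simp [mNN]
  · rintro ⟨cX, F, cF, hF, h⟩
    refine (mem_mSym_iff hs X).2 ⟨cX, fun q w hw => ?_⟩
    rw [chain F cF cX hF, hw, ← h q]
    simp only [map_smul, Prod.smul_fst, smul_eq_mul]
    have : (mNN κ (mpp m q)).1 = 1 := rfl
    rw [this]
    module

lemma mSym_bracket {κ : Fin m → Fin m → ℝ} {X Y : MPt m → MPt m}
    (hX : X ∈ mSym m κ) (hY : Y ∈ mSym m κ) : mBr m X Y ∈ mSym m κ := by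
  have cbr : ∀ {X Y : MPt m → MPt m}, ContDiff ℝ (⊤ : ℕ∞) X → ContDiff ℝ (⊤ : ℕ∞) Y →
      ContDiff ℝ (⊤ : ℕ∞) (mBr m X Y) := fun {X Y} hX hY =>
    ((hY.fderiv_right (by simp)).clm_apply hX).sub ((hX.fderiv_right (by simp)).clm_apply hY)
  refine ⟨cbr hX.1 hY.1, fun W hW hsec q => ?_⟩
  have := VectorField.leibniz_identity_lieBracket (𝕜 := ℝ) mtwo_le (hX.1.contDiffAt (x := q))
    (hY.1.contDiffAt (x := q)) (hW.contDiffAt (x := q))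
  have h1 : mBr m (mBr m X Y) W q = mBr m X (mBr m Y W) q - mBr m Y (mBr m X W) q := by
    rw [eq_sub_iff_add_eq]; exact this.symm
  rw [h1]
  exact Submodule.sub_mem _ (hX.2 _ (cbr hY.1 hW) (hY.2 W hW hsec) q)
    (hY.2 _ (cbr hX.1 hW) (hX.2 W hW hsec) q)

lemma mSym_unique (hm : 2 ≤ m) {κ : Fin m → Fin m → ℝ} (hs : ∀ i j, κ i j = κ j i)
    {X Y : MPt m → MPt m} (hX : X ∈ mSym m κ) (hY : Y ∈ mSym m κ)
    (h : ∀ q, mpi m (X q) = mpi m (Y q)) : X = Y := by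
  obtain ⟨cX, F, cF, hF, h1⟩ := (mSym_iff_lift hm hs X).1 hX
  obtain ⟨cY, F', cF', hF', h2⟩ := (mSym_iff_lift hm hs Y).1 hY
  have : F = F' := by
    ext1 u
    have := h (mmk m (u, 0))
    rwa [hF, hF', mpi_mmk] at this
  subst this
  ext1 q
  refine mext (h q) ?_
  have h3 := (h1 q).symm.trans (h2 q)
  exact congrArg (fun v : ME m => v.2.1) h3

end MongeGeometry

section MongeAlgebra

variable {m : ℕ}

/-- The flat conformal metric on the base. -/
noncomputable def mgE (κ : Fin m → Fin m → ℝ) : ME m →L[ℝ] ME m →L[ℝ] ℝ :=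
  LinearMap.toContinuousBilinearMap (LinearMap.mk₂ ℝ
    (fun v w : ME m => mkap κ v.2.1 w.2.1 - v.1 * w.2.2 - v.2.2 * w.1)
    (by intros; simp; ring) (by intros; simp; ring) (by intros; simp; ring)
    (by intros; simp; ring))

lemma mgE_apply (κ : Fin m → Fin m → ℝ) (v w : ME m) :
    mgE κ v w = mkap κ v.2.1 w.2.1 - v.1 * w.2.2 - v.2.2 * w.1 := rfl

lemma mkap_gram {κ : Fin m → Fin m → ℝ} {P : Matrix (Fin m) (Fin m) ℝ} {d : Fin m → ℝ}
    (hP : P.transpose * Matrix.of κ * P = Matrix.diagonal d) (a b : Fin m → ℝ) :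
    mkap κ (P.mulVec a) (P.mulVec b) = ∑ i, d i * a i * b i := by
  have h1 : mkap κ (P.mulVec a) (P.mulVec b) =
      (P.mulVec a) ⬝ᵥ (Matrix.of κ).mulVec (P.mulVec b) := by
    simp [mkap, Matrix.toBilin'_apply']
  rw [h1, ← Matrix.vecMul_transpose, ← Matrix.dotProduct_mulVec, Matrix.mulVec_mulVec,
    Matrix.mulVec_mulVec, hP]
  simp only [dotProduct, Matrix.mulVec_diagonal]
  exact Finset.sum_congr rfl fun i _ => by ring

lemma mgE_hyp (hm : 2 ≤ m) {κ : Fin m → Fin m → ℝ} (hs : ∀ i j, κ i j = κ j i)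
    {P : Matrix (Fin m) (Fin m) ℝ} (hu : IsUnit P.det) {d : Fin m → ℝ} (hd : ∀ i, d i ≠ 0)
    (hP : P.transpose * Matrix.of κ * P = Matrix.diagonal d) :
    ∃ y0, MHyp (mgE κ) (1, 0, 0) (0, 0, 1) y0 := by
  let i0 : Fin m := ⟨0, by omega⟩
  refine ⟨(0, P.mulVec (Pi.single i0 1), 0), ?_, ?_, ?_, ?_, ?_, ?_, ?_, ?_⟩
  · intro v w
    rw [mgE_apply, mgE_apply, mkap_symm hs]; ring
  · rintro ⟨a, p, b⟩ h
    have ha := h (0, 0, 1)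
    have hb := h (1, 0, 0)
    simp [mgE_apply] at ha hb
    have hp : p = 0 := by
      obtain ⟨a', rfl⟩ : ∃ a', P.mulVec a' = p :=
        ⟨P⁻¹.mulVec p, by rw [Matrix.mulVec_mulVec, Matrix.mul_nonsing_inv _ hu,
          Matrix.one_mulVec]⟩
      have : a' = 0 := by
        ext i
        have := h (0, P.mulVec (Pi.single i 1), 0)
        simp only [mgE_apply, mkap_gram hP] at this
        simpa [Pi.single_apply, hd i] using this
      rw [this, Matrix.mulVec_zero]
    rw [ha, hb, hp]; rfl
  · simp [mgE_apply]
  · simp [mgE_apply]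
  · simp [mgE_apply]
  · simp [mgE_apply]
  · simp [mgE_apply]
  · simp only [mgE_apply, mkap_gram hP]
    simpa [Pi.single_apply] using hd i0

lemma exists_index_equiv {r : ℕ} (hr : r ≤ m) :
    ∃ e : Fin m ⊕ Fin 4 ≃ Fin (m + 4),
      (∀ i : Fin m, ((e (Sum.inl i) : Fin (m + 4)) : ℕ) < r + 2 ↔ (i : ℕ) < r) ∧
      ∀ k : Fin 4, ((e (Sum.inr k) : Fin (m + 4)) : ℕ) = r + k := by
  let f : Fin m ⊕ Fin 4 → Fin (m + 4) := fun c => match c with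
    | Sum.inl i => if h : (i : ℕ) < r then ⟨i, by omega⟩ else ⟨i + 4, by omega⟩
    | Sum.inr k => ⟨r + k, by omega⟩
  have hl : ∀ i : Fin m, (f (Sum.inl i) : ℕ) = if (i : ℕ) < r then (i : ℕ) else i + 4 := by
    intro i
    simp only [f]
    split_ifs <;> rfl
  have hrr : ∀ k : Fin 4, (f (Sum.inr k) : ℕ) = r + k := fun k => rfl
  have hinj : Function.Injective f := by
    rintro (i | i) (j | j) h <;> have h' := congrArg Fin.val h <;> simp only [hl, hrr] at h'
    · congr 1; ext; split_ifs at h' <;> omega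
    · exfalso; split_ifs at h' <;> omega
    · exfalso; split_ifs at h' <;> omega
    · congr 1; ext; omega
  have hbij : Function.Bijective f :=
    (Fintype.bijective_iff_injective_and_card f).2 ⟨hinj, by simp⟩
  refine ⟨Equiv.ofBijective f hbij, ?_, ?_⟩
  · intro i
    rw [Equiv.ofBijective_apply, hl]
    split_ifs <;> omega
  · intro k; rfl

lemma exists_ambient_equiv {r : ℕ} (hr : r ≤ m) {κ : Fin m → Fin m → ℝ}
    {P : Matrix (Fin m) (Fin m) ℝ}
    (hP : P.transpose * Matrix.of κ * P =
      Matrix.diagonal (fun i : Fin m => if (i : ℕ) < r then (1 : ℝ) else -1)) :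
    ∃ T : (Fin (m + 4) → ℝ) ≃ₗ[ℝ] ℝ × ME m × ℝ, ∀ h k, mG (mgE κ) (T h) (T k) =
      ∑ i : Fin (m + 4), (if (i : ℕ) < r + 2 then (1 : ℝ) else -1) * h i * k i := by
  obtain ⟨e, e1, e2⟩ := exists_index_equiv hr
  let T : (Fin (m + 4) → ℝ) →ₗ[ℝ] ℝ × ME m × ℝ :=
    { toFun := fun h => (h (e (Sum.inr 1)) + h (e (Sum.inr 3)),
        (h (e (Sum.inr 0)) + h (e (Sum.inr 2)), P.mulVec (fun i => h (e (Sum.inl i))),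
          (h (e (Sum.inr 2)) - h (e (Sum.inr 0))) / 2),
        (h (e (Sum.inr 3)) - h (e (Sum.inr 1))) / 2)
      map_add' := by
        intro h k
        refine Prod.ext ?_ (Prod.ext (Prod.ext ?_ (Prod.ext ?_ ?_)) ?_)
        · simp; ring
        · simp; ring
        · exact P.mulVec_add (fun i => h (e (Sum.inl i))) (fun i => k (e (Sum.inl i)))
        · simp; ring
        · simp; ring
      map_smul' := by
        intro c h
        refine Prod.ext ?_ (Prod.ext (Prod.ext ?_ (Prod.ext ?_ ?_)) ?_)
        · simp; ring
        · simp; ring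
        · exact P.mulVec_smul c (fun i => h (e (Sum.inl i)))
        · simp; ring
        · simp; ring }
  have hT : ∀ h k, mG (mgE κ) (T h) (T k) =
      ∑ i : Fin (m + 4), (if (i : ℕ) < r + 2 then (1 : ℝ) else -1) * h i * k i := by
    intro h k
    rw [← e.sum_comp, Fintype.sum_sum_type, Fin.sum_univ_four]
    simp only [e1, e2]
    simp only [mG, mgE_apply, T, LinearMap.coe_mk, AddHom.coe_mk, mkap_gram hP]
    norm_num
    ring
  have hinj : Function.Injective T := by
    rw [injective_iff_map_eq_zero]
    intro h h0
    ext i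
    have := hT h (Pi.single i 1)
    rw [h0] at this
    have h1 : mG (mgE κ) 0 (T (Pi.single i 1)) = 0 := by simp [mG]
    rw [h1] at this
    simp only [Pi.single_apply, mul_ite, mul_one, mul_zero, Finset.sum_ite_eq', Finset.mem_univ,
      if_true] at this
    split_ifs at this <;> simpa using this.symm
  have hdim : Module.finrank ℝ (Fin (m + 4) → ℝ) = Module.finrank ℝ (ℝ × ME m × ℝ) := by
    simp; ring
  exact ⟨T.linearEquivOfInjective hinj hdim, fun h k => by
    simpa using hT h k⟩

lemma mskew_iff {n : ℕ} (d : Fin n → ℝ) (A : Matrix (Fin n) (Fin n) ℝ) :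
    A ∈ skewAdjointMatricesLieSubalgebra (Matrix.diagonal d) ↔
      ∀ h k, ∑ i, d i * (A.mulVec h) i * k i = - ∑ i, d i * h i * (A.mulVec k) i := by
  rw [mem_skewAdjointMatricesLieSubalgebra, mem_skewAdjointMatricesSubmodule]
  have hd : ∀ x y : Fin n → ℝ, ∑ i, d i * x i * y i = x ⬝ᵥ (Matrix.diagonal d).mulVec y := by
    intro x y
    simp only [dotProduct, Matrix.mulVec_diagonal]
    exact Finset.sum_congr rfl fun i _ => by ring
  simp only [hd]
  unfold Matrix.IsSkewAdjoint Matrix.IsAdjointPair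
  constructor
  · intro h x y
    rw [← Matrix.vecMul_transpose, ← Matrix.dotProduct_mulVec, Matrix.mulVec_mulVec, h,
      Matrix.mulVec_mulVec, Matrix.mul_neg, Matrix.neg_mulVec, dotProduct_neg]
  · intro h
    ext i j
    have := h (Pi.single i 1) (Pi.single j 1)
    rw [← Matrix.vecMul_transpose, ← Matrix.dotProduct_mulVec, Matrix.mulVec_mulVec,
      Matrix.mulVec_mulVec] at this
    simpa using this

/-- The lift of a field on the base. -/
noncomputable def mlift (κ : Fin m → Fin m → ℝ) (F : ME m → ME m) : MPt m → MPt m := fun q =>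
  mmk m (F (mpi m q), (fderiv ℝ F (mpi m q) (mNN κ (mpp m q))).2.1 -
    (fderiv ℝ F (mpi m q) (mNN κ (mpp m q))).1 • mpp m q)

lemma mlift_mem (hm : 2 ≤ m) {κ : Fin m → Fin m → ℝ} (hs : ∀ i j, κ i j = κ j i)
    {F : ME m → ME m} (hF : ContDiff ℝ (⊤ : ℕ∞) F)
    (hN : ∀ u p, mgE κ (fderiv ℝ F u (mNN κ p)) (mNN κ p) = 0) : mlift κ F ∈ mSym m κ := by
  have c1 : ContDiff ℝ (⊤ : ℕ∞) fun q => fderiv ℝ F (mpi m q) (mNN κ (mpp m q)) :=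
    (ContDiff.comp (hF.fderiv_right (by simp)) (mpi m).contDiff).clm_apply
      ((mNN_contDiff κ).comp (mpp m).contDiff)
  refine (mSym_iff_lift hm hs _).2 ⟨?_, F, hF, fun q => rfl, fun q => ?_⟩
  · exact (mmk m).contDiff.comp ((hF.comp (mpi m).contDiff).prodMk
      (c1.snd.fst.sub (c1.fst.smul (mpp m).contDiff)))
  · have := hN (mpi m q) (mpp m q)
    have e : mpp m (mlift κ F q) = (fderiv ℝ F (mpi m q) (mNN κ (mpp m q))).2.1 -
      (fderiv ℝ F (mpi m q) (mNN κ (mpp m q))).1 • mpp m q := rfl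
    rw [e, mdN_apply]
    generalize fderiv ℝ F (mpi m q) (mNN κ (mpp m q)) = a at *
    generalize mpp m q = p at *
    refine Prod.ext ?_ (Prod.ext ?_ ?_)
    · simp [mNN]
    · simp [mNN]
    · simp only [mgE_apply, mNN] at this
      rw [mkap_symm hs] at this
      simp [mNN]
      linarith

lemma mchain {F : ME m → ME m} {X : MPt m → MPt m} (cF : Differentiable ℝ F)
    (cX : Differentiable ℝ X) (h : ∀ q, mpi m (X q) = F (mpi m q)) (q w : MPt m) :
    mpi m (fderiv ℝ X q w) = fderiv ℝ F (mpi m q) (mpi m w) := by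
  have h1 : HasFDerivAt (fun q => mpi m (X q)) ((mpi m).comp (fderiv ℝ X q)) q :=
    (mpi m).hasFDerivAt.comp q (cX q).hasFDerivAt
  have h2 : HasFDerivAt (fun q => F (mpi m q)) ((fderiv ℝ F (mpi m q)).comp (mpi m)) q :=
    (cF _).hasFDerivAt.comp q (mpi m).hasFDerivAt
  rw [funext h] at h1
  exact congrArg (fun l => l w) (h1.unique h2)

lemma mSym_killing (hm : 2 ≤ m) {κ : Fin m → Fin m → ℝ} (hs : ∀ i j, κ i j = κ j i)
    {X : MPt m → MPt m} (hX : X ∈ mSym m κ) :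
    ∃ F : ME m → ME m, ContDiff ℝ (⊤ : ℕ∞) F ∧ (∀ q, mpi m (X q) = F (mpi m q)) ∧
      ∀ u p, mgE κ (fderiv ℝ F u (mNN κ p)) (mNN κ p) = 0 := by
  obtain ⟨cX, F, cF, hF, h⟩ := (mSym_iff_lift hm hs X).1 hX
  refine ⟨F, cF, hF, fun u p => ?_⟩
  have := h (mmk m (u, p))
  rw [mpi_mmk, mpp_mmk, mdN_apply] at this
  generalize fderiv ℝ F u (mNN κ p) = a at *
  generalize mpp m (X (mmk m (u, p))) = b at *
  have h1 := congrArg (fun v : ME m => v.2.1) this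
  have h2 := congrArg (fun v : ME m => v.2.2) this
  simp [mNN] at h1 h2
  rw [← h1] at h2
  simp only [mgE_apply, mNN]
  rw [mkap_symm hs]
  simp at h2
  linarith

end MongeAlgebra

/-- Let `m ≥ 2` and let `κ` be a nondegenerate symmetric real
`m×m` matrix of signature `(r, s)`, `r + s = m`.  The Lie algebra of infinitesimal
symmetries of the canonical distribution of the Monge equation
`ż = (1/2) κ_{ij} ẏⁱ ẏʲ` on `ℝ^{2m+2}` is finite dimensional and isomorphic, as a
real Lie algebra, to `so(r+2, s+2)`. -/
theorem statement17 (m r s : ℕ) (hm : 2 ≤ m) (hrs : r + s = m)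
    (κ : Fin m → Fin m → ℝ) (hsymm : ∀ i j, κ i j = κ j i)
    (hsig : ∃ P : Matrix (Fin m) (Fin m) ℝ, IsUnit P.det ∧
        P.transpose * Matrix.of κ * P =
          Matrix.diagonal (fun i : Fin m => if (i : ℕ) < r then (1 : ℝ) else -1)) :
    ∃ Φ : ↥(skewAdjointMatricesLieSubalgebra
          (Matrix.diagonal (fun i : Fin (m + 4) => if (i : ℕ) < r + 2 then (1 : ℝ) else -1)))
        →ₗ[ℝ] (MPt m → MPt m),
      Function.Injective Φ ∧ Set.range Φ = mSym m κ ∧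
      ∀ A B, Φ ⁅A, B⁆ = mBr m (Φ A) (Φ B) := by
  obtain ⟨P, hu, hP⟩ := hsig
  obtain ⟨y0, H⟩ := mgE_hyp hm hsymm hu (fun i => by split_ifs <;> norm_num) hP
  obtain ⟨T, hT⟩ := exists_ambient_equiv (by omega : r ≤ m) hP
  set J := Matrix.diagonal (fun i : Fin (m + 4) => if (i : ℕ) < r + 2 then (1 : ℝ) else -1) with hJ
  -- the ambient endomorphism
  let hat : Matrix (Fin (m + 4)) (Fin (m + 4)) ℝ →ₗ[ℝ]
      ((ℝ × ME m × ℝ) →L[ℝ] (ℝ × ME m × ℝ)) :=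
    -((LinearMap.toContinuousLinearMap.toLinearMap ∘ₗ T.conj.toLinearMap) ∘ₗ
      Matrix.toLin'.toLinearMap)
  have hhat : ∀ A v, hat A v = -T (A.mulVec (T.symm v)) := fun A v => by
    simp [hat, LinearEquiv.conj_apply]
  have hskew : ∀ A, A ∈ skewAdjointMatricesLieSubalgebra J ↔ MSkew (mgE κ) (hat A) := by
    intro A
    have hneg1 : ∀ a b, mG (mgE κ) (-a) b = - mG (mgE κ) a b := by
      intro a b; simp [mG]; ring
    have hneg2 : ∀ a b, mG (mgE κ) a (-b) = - mG (mgE κ) a b := by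
      intro a b; simp [mG]; ring
    rw [hJ, mskew_iff]
    constructor
    · intro h a b
      rw [hhat, hhat, hneg1, hneg2]
      have := h (T.symm a) (T.symm b)
      rw [← hT, ← hT, T.apply_symm_apply, T.apply_symm_apply] at this
      rw [this]
    · intro h a b
      have := h (T a) (T b)
      rw [hhat, hhat, hneg1, hneg2, T.symm_apply_apply, T.symm_apply_apply, hT, hT] at this
      linarith
  have hbr : ∀ A B, hat (A * B - B * A) =
      -((hat A).comp (hat B) - (hat B).comp (hat A)) := by
    intro A B
    refine ContinuousLinearMap.ext fun v => ?_
    simp only [hhat, Matrix.sub_mulVec, neg_apply, sub_apply, ContinuousLinearMap.comp_apply,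
      ← Matrix.mulVec_mulVec, map_neg, map_sub, Matrix.mulVec_neg, T.symm_apply_apply]
    abel
  have hD : ∀ A, Differentiable ℝ (mvf (mgE κ) (hat A)) := fun A u =>
    (H.hasFDerivAt_mvf _ u).differentiableAt
  have hfd : ∀ A u, fderiv ℝ (mvf (mgE κ) (hat A)) u = mvfD (mgE κ) (hat A) u := fun A u =>
    (H.hasFDerivAt_mvf _ u).fderiv
  have hfd2 : ∀ L u, fderiv ℝ (mvf (mgE κ) L) u = mvfD (mgE κ) L u := fun L u =>
    (H.hasFDerivAt_mvf _ u).fderiv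
  let Φ : ↥(skewAdjointMatricesLieSubalgebra J) →ₗ[ℝ] (MPt m → MPt m) :=
    { toFun := fun A => mlift κ (mvf (mgE κ) (hat A))
      map_add' := by
        intro A B
        have hc : hat (↑(A + B)) = hat ↑A + hat ↑B := hat.map_add _ _
        ext1 q
        refine mext ?_ ?_
        · simp only [mlift, Pi.add_apply, map_add, mpi_mmk, mvf, hc, add_apply,
            Prod.fst_add, Prod.snd_add]
          module
        · simp only [mlift, Pi.add_apply, map_add, mpp_mmk, hfd2, mvfD_apply,
            hc, add_apply, Prod.fst_add, Prod.snd_add, Prod.fst_sub,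
            Prod.snd_sub, Prod.smul_fst, Prod.smul_snd, smul_eq_mul]
          module
      map_smul' := by
        intro c A
        have hc : hat (↑(c • A)) = c • hat ↑A := hat.map_smul c _
        ext1 q
        refine mext ?_ ?_
        · simp only [mlift, Pi.smul_apply, map_smul, mpi_mmk, mvf, hc,
            smul_apply, Prod.smul_fst, Prod.smul_snd, RingHom.id_apply, smul_eq_mul]
          module
        · simp only [mlift, Pi.smul_apply, map_smul, mpp_mmk, hfd2, mvfD_apply,
            hc, smul_apply, Prod.fst_add, Prod.snd_add, Prod.fst_sub,
            Prod.snd_sub, Prod.smul_fst, Prod.smul_snd, smul_eq_mul, RingHom.id_apply]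
          module }
  have hΦ : ∀ A q, mpi m (Φ A q) = mvf (mgE κ) (hat A) (mpi m q) := fun A q => rfl
  have hmem : ∀ A, Φ A ∈ mSym m κ := by
    intro A
    refine mlift_mem hm hsymm (mvf_contDiff _ _) fun u p => ?_
    rw [hfd, H.mvf_killing ((hskew A).1 A.2)]
    have : mgE κ (mNN κ p) (mNN κ p) = 0 := by
      simp [mgE_apply, mNN]; ring
    rw [this, mul_zero]
  refine ⟨Φ, ?_, ?_, ?_⟩
  · rw [injective_iff_map_eq_zero]
    intro A hA
    have h1 : mvf (mgE κ) (hat A) = 0 := by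
      ext1 u
      have := hΦ A (mmk m (u, 0))
      rw [hA, mpi_mmk] at this
      rw [← this]; simp
    have h2 := H.mvf_inj ((hskew A).1 A.2) h1
    have h3 : ∀ v, (A : Matrix (Fin (m + 4)) (Fin (m + 4)) ℝ).mulVec v = 0 := by
      intro v
      have := congrArg (fun l => l (T v)) h2
      simp only [hhat, T.symm_apply_apply] at this
      simpa using this
    apply Subtype.ext
    have h4 : (A : Matrix (Fin (m + 4)) (Fin (m + 4)) ℝ) = 0 := by
      ext i j
      have := congrFun (h3 (Pi.single j 1)) i
      simpa using this
    simpa using h4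
  · apply Set.eq_of_subset_of_subset
    · rintro _ ⟨A, rfl⟩
      exact hmem A
    · intro X hX
      obtain ⟨F, cF, hF, hN⟩ := mSym_killing hm hsymm hX
      obtain ⟨t, b, S, c, hS, hFq⟩ := H.killing F cF (by
        rintro u ⟨p1, p, p2⟩ h1 h2
        have e1 : p2 = 0 := by simpa [mgE_apply] using h1
        have e2 : p1 = 0 := by simpa [mgE_apply] using h2
        subst e1 e2
        have : ((1 : ℝ), (0 : Fin m → ℝ), (0 : ℝ)) + ((0 : ℝ), p, (0 : ℝ)) +
            ((1 / 2) * mgE κ ((0 : ℝ), p, (0 : ℝ)) ((0 : ℝ), p, (0 : ℝ))) •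
              ((0 : ℝ), (0 : Fin m → ℝ), (1 : ℝ)) = mNN κ p := by
          simp [mNN, mgE_apply]
        rw [this]
        exact hN u p)
      obtain ⟨B, hB, hBF⟩ := H.mvf_surj t b S c hS
      let A : Matrix (Fin (m + 4)) (Fin (m + 4)) ℝ :=
        -(LinearMap.toMatrix' (T.symm.conj (B : (ℝ × ME m × ℝ) →ₗ[ℝ] (ℝ × ME m × ℝ))))
      have hA : hat A = B := by
        refine ContinuousLinearMap.ext fun v => ?_
        rw [hhat]
        simp only [A, Matrix.neg_mulVec, ← Matrix.toLin'_apply, Matrix.toLin'_toMatrix']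
        simp [LinearEquiv.conj_apply]
      refine ⟨⟨A, (hskew A).2 (hA ▸ hB)⟩, ?_⟩
      refine mSym_unique hm hsymm (hmem _) hX fun q => ?_
      rw [hΦ, hF, hFq, ← hBF]
      change mvf (mgE κ) (hat A) _ = _
      rw [hA]
  · intro A B
    refine mSym_unique hm hsymm (hmem _) (mSym_bracket (hmem A) (hmem B)) fun q => ?_
    have hdA : Differentiable ℝ (Φ A) := (hmem A).1.differentiable (by simp)
    have hdB : Differentiable ℝ (Φ B) := (hmem B).1.differentiable (by simp)
    rw [hΦ]
    simp only [mBr, map_sub]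
    rw [mchain (hD B) hdB (hΦ B), mchain (hD A) hdA (hΦ A), hΦ, hΦ, hfd, hfd]
    have e1 : hat (↑⁅A, B⁆ : Matrix (Fin (m + 4)) (Fin (m + 4)) ℝ) =
        -((hat A).comp (hat B) - (hat B).comp (hat A)) := by
      exact hbr A B
    have e2 := H.mvf_bracket ((hskew A).1 A.2) ((hskew B).1 B.2) (mpi m q)
    rw [← neg_inj, neg_sub, ← e2, e1]
    simp only [mvf, neg_apply, Prod.fst_neg, Prod.snd_neg]
    module
end
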